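/- arXiv:2204.05069 — 4 statements merged into one kernel-verified Lean document; each statement's English description precedes it below -/
import Mathlib

section
/- Let K be a field of characteristic zero, let a2(x), a0(x) ∈ K[x], and let D = y∂x + (a2(x)y² + a0(x))∂y be the K-derivation of K[x,y] determined by D(x) = y and D(y) = a2(x)y² + a0(x). Then D is simple if and only if a0(x) is a nonzero constant (a0(x) ∈ K*) and deg a2(x) ≥ 1. -/
/-- A `K`-derivation `D` of `R` is *simple* if `R` has no `D`-stable ideal
other than `0` and `R`. -/
def Derivation.IsSimple {K R : Type*} [CommRing K] [CommRing R] [Algebra K R]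
    (D : Derivation K R R) : Prop :=
  ∀ I : Ideal R, (∀ a ∈ I, D a ∈ I) → I = ⊥ ∨ I = ⊤


open Polynomial

namespace Derivation

variable {K R S : Type*} [CommRing K] [CommRing R] [CommRing S] [Algebra K R] [Algebra K S]

lemma mem_span_of_forall_mem_span (D : Derivation K R R) {s : Set R}
    (hs : ∀ a ∈ s, D a ∈ Ideal.span s) : ∀ a ∈ Ideal.span s, D a ∈ Ideal.span s := by
  intro a ha
  induction ha using Submodule.span_induction with
  | mem x hx => exact hs x hx
  | zero => simp
  | add x y _ _ hx hy => simpa using add_mem hx hy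
  | smul r x hxs hx =>
    rw [smul_eq_mul, D.leibniz]
    exact add_mem (Ideal.mul_mem_left _ _ hx) (Ideal.mul_mem_right _ _ hxs)

lemma IsSimple.eq_zero_or_isUnit_of_dvd {D : Derivation K R R} (hD : D.IsSimple) {f : R}
    (hf : f ∣ D f) : f = 0 ∨ IsUnit f := by
  rw [← Ideal.span_singleton_eq_bot, ← Ideal.span_singleton_eq_top]
  refine hD _ (D.mem_span_of_forall_mem_span ?_)
  rintro _ rfl
  exact Ideal.mem_span_singleton.mpr hf

lemma IsSimple.of_algEquiv {D : Derivation K R R} {D' : Derivation K S S} (hD : D.IsSimple)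
    (e : R ≃ₐ[K] S) (h : ∀ r, D' (e r) = e (D r)) : D'.IsSimple := by
  intro I hI
  have hcomap : (I.comap e).map e = I := Ideal.map_comap_of_surjective e e.surjective I
  rcases hD (I.comap e) fun a ha => by
    rw [Ideal.mem_comap, ← h]
    exact hI _ ha with h0 | h0
  · left
    rw [← hcomap, h0, Ideal.map_bot]
  · right
    rw [← hcomap, h0, Ideal.map_top]

/-- The derivation obtained from `D` by transport along an algebra isomorphism. -/
def conj (D : Derivation K R R) (e : R ≃ₐ[K] S) : Derivation K S S :=
  Derivation.mk' (e.toLinearMap ∘ₗ D.toLinearMap ∘ₗ e.symm.toLinearMap) fun a b => by simp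

lemma conj_apply (D : Derivation K R R) (e : R ≃ₐ[K] S) (s : S) :
    D.conj e s = e (D (e.symm s)) :=
  rfl

lemma isSimple_conj_iff (D : Derivation K R R) (e : R ≃ₐ[K] S) :
    (D.conj e).IsSimple ↔ D.IsSimple :=
  ⟨fun h => h.of_algEquiv e.symm fun s => by simp [conj_apply],
    fun h => h.of_algEquiv e fun r => by simp [conj_apply]⟩

end Derivation

namespace Polynomial

lemma exists_dvd_C_mul_of_minimal {R : Type*} [CommRing R] [IsDomain R] {I : Ideal R[X]}
    {f : R[X]} (hf : f ∈ I) (hf0 : f ≠ 0)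
    (hmin : ∀ h ∈ I, h ≠ 0 → f.natDegree ≤ h.natDegree) {h : R[X]} (hh : h ∈ I) :
    ∃ a : R, a ≠ 0 ∧ f ∣ C a * h := by
  induction hn : h.natDegree using Nat.strong_induction_on generalizing h with
  | _ n ih =>
    by_cases h0 : h = 0
    · exact ⟨1, one_ne_zero, by simp [h0]⟩
    have hle := hmin h hh h0
    have key : C f.leadingCoeff * h - C h.leadingCoeff * X ^ (h.natDegree - f.natDegree) * f ∈ I :=
      I.sub_mem (I.mul_mem_left _ hh) (I.mul_mem_left _ hf)
    have hlc : f.leadingCoeff ≠ 0 := leadingCoeff_ne_zero.mpr hf0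
    rcases Nat.eq_zero_or_pos h.natDegree with hz | hpos
    · have hfz : f.natDegree = 0 := by omega
      obtain ⟨r, rfl⟩ := natDegree_eq_zero.mp hfz
      exact ⟨r, by simpa using hf0, dvd_mul_right _ _⟩
    · have hlt := natDegree_cancelLeads_lt_of_natDegree_le_natDegree hle hpos
      rw [cancelLeads, Nat.sub_eq_zero_of_le hle, pow_zero, mul_one] at hlt
      obtain ⟨a, ha, hdvd⟩ := ih _ (hn ▸ hlt) key rfl
      refine ⟨a * f.leadingCoeff, mul_ne_zero ha hlc, ?_⟩
      have := dvd_add hdvd (Dvd.intro_left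
        (C a * (C h.leadingCoeff * X ^ (h.natDegree - f.natDegree))) rfl)
      convert this using 1
      rw [C_mul]
      ring

lemma IsPrimitive.dvd_of_dvd_C_mul {R : Type*} [CommRing R] [IsDomain R] [NormalizedGCDMonoid R]
    {f h : R[X]} (hf : f.IsPrimitive) {a : R} (ha : a ≠ 0) (hdvd : f ∣ C a * h) : f ∣ h := by
  refine hf.dvd_of_fraction_map_dvd_fraction_map (K := FractionRing R) ?_
  have := Polynomial.map_dvd (algebraMap R (FractionRing R)) hdvd
  rw [Polynomial.map_mul, map_C] at this
  refine (IsUnit.dvd_mul_left ?_).mp this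
  rw [isUnit_C, isUnit_iff_ne_zero]
  simpa using ha

lemma exists_isPrimitive_dvd_of_ideal_ne_bot {R : Type*} [CommRing R] [IsDomain R]
    [NormalizedGCDMonoid R] {I : Ideal R[X]} (hI : I ≠ ⊥) :
    ∃ (c : R) (f : R[X]), c ≠ 0 ∧ f.IsPrimitive ∧ C c * f ∈ I ∧ ∀ h ∈ I, f ∣ h := by
  classical
  obtain ⟨g, hg, hg0⟩ := Submodule.exists_mem_ne_zero_of_ne_bot hI
  obtain ⟨f, ⟨hf, hf0⟩, hmin⟩ := exists_minimalFor_of_wellFoundedLT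
    (fun p : R[X] => p ∈ I ∧ p ≠ 0) natDegree ⟨g, hg, hg0⟩
  have hmin' : ∀ h ∈ I, h ≠ 0 → f.natDegree ≤ h.natDegree := fun h hh h0 =>
    (le_total f.natDegree h.natDegree).elim id (hmin ⟨hh, h0⟩)
  refine ⟨f.content, f.primPart, by simpa [content_eq_zero_iff] using hf0,
    f.isPrimitive_primPart, by rwa [← f.eq_C_content_mul_primPart], fun h hh => ?_⟩
  obtain ⟨a, ha, hdvd⟩ := exists_dvd_C_mul_of_minimal hf hf0 hmin' hh
  exact f.isPrimitive_primPart.dvd_of_dvd_C_mul ha (f.primPart_dvd.trans hdvd)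

lemma natDegree_derivative_sub_mul {K : Type*} [Field K] {p q : K[X]} (hp : 1 ≤ p.natDegree)
    (hq : q ≠ 0) : (derivative q - p * q).natDegree = p.natDegree + q.natDegree := by
  have hp0 : p ≠ 0 := by rintro rfl; simp at hp
  rw [natDegree_sub_eq_right_of_natDegree_lt, natDegree_mul hp0 hq]
  rw [natDegree_mul hp0 hq]
  have := natDegree_derivative_le q
  omega

/-- A recurrence of first order linear differential equations all of whose solutions starting
with a nonzero constant have no vanishing term. -/
lemma ne_zero_of_derivative_recurrence {K : Type*} [Field K] [CharZero K] {a l : K[X]}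
    (ha : 1 ≤ a.natDegree) {N : ℕ} {g : ℕ → K[X]} {c : ℕ → K} (hc : c 0 ≠ 0) (g0 : g 0 ≠ 0)
    (g0' : (g 0).natDegree = 0)
    (h1 : derivative (g 1) - a * g 1 = l * g 0)
    (h2 : ∀ j < N, derivative (g (j + 2)) - ((j + 2 : ℕ) : K[X]) * a * g (j + 2) + C (c j) * g j =
      l * g (j + 1)) (hN : 0 < N) : g (N + 1) ≠ 0 := by
  have hdeg : ∀ j : ℕ, (((j + 2 : ℕ) : K[X]) * a).natDegree = a.natDegree := fun j => by
    rw [← map_natCast (C : K →+* K[X]), natDegree_C_mul (by exact_mod_cast (by omega : j + 2 ≠ 0))]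
  have hl : l ≠ 0 := by
    rintro rfl
    have g1 : g 1 = 0 := by
      by_contra h
      have := natDegree_derivative_sub_mul ha h
      rw [h1] at this
      simp at this
      omega
    have e := h2 0 hN
    rw [g1, mul_zero] at e
    have hne : C (c 0) * g 0 ≠ 0 := mul_ne_zero (by simpa using hc) g0
    have g2 : g 2 ≠ 0 := by
      intro h
      simp only [zero_add, h] at e
      simp at e
      tauto
    have := natDegree_derivative_sub_mul (hdeg 0 ▸ ha) g2
    rw [eq_neg_of_add_eq_zero_left e, natDegree_neg, natDegree_C_mul hc, hdeg] at this
    omega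
  have g1 : g 1 ≠ 0 := by
    intro h
    rw [h] at h1
    simp at h1
    tauto
  have hla : 1 ≤ l.natDegree ∧ a.natDegree ≤ l.natDegree := by
    have := natDegree_derivative_sub_mul ha g1
    rw [h1, natDegree_mul hl g0] at this
    omega
  suffices ∀ j ≤ N, g (j + 1) ≠ 0 ∧ (g j).natDegree ≤ (g (j + 1)).natDegree from (this N le_rfl).1
  intro j
  induction j with
  | zero => exact fun _ => ⟨g1, by omega⟩
  | succ j ih =>
    intro hj
    obtain ⟨hne, hle⟩ := ih (by omega)
    have e := h2 j (by omega)
    rw [← eq_sub_iff_add_eq] at e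
    have hd : (l * g (j + 1) - C (c j) * g j).natDegree = l.natDegree + (g (j + 1)).natDegree := by
      rw [natDegree_sub_eq_left_of_natDegree_lt, natDegree_mul hl hne]
      rw [natDegree_mul hl hne]
      have := natDegree_C_mul_le (c j) (g j)
      omega
    have g2 : g (j + 2) ≠ 0 := by
      intro h
      rw [← e, h] at hd
      simp at hd
      omega
    refine ⟨g2, ?_⟩
    have := natDegree_derivative_sub_mul (hdeg j ▸ ha) g2
    rw [e, hd, hdeg] at this
    change _ ≤ (g (j + 2)).natDegree
    omega

section Bivariate

variable {K : Type*} [Field K] {D : Derivation K K[X][X] K[X][X]} {a b : K[X]}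

lemma derivation_C_eq (hx : D (C X) = X) (p : K[X]) : D (C p) = C (derivative p) * X := by
  induction p using Polynomial.induction_on' with
  | add p q hp hq => simp [hp, hq, add_mul]
  | monomial n r =>
    have hr : D (C (C r)) = 0 := D.map_algebraMap r
    rw [← C_mul_X_pow_eq_monomial, C_mul, C_pow, D.leibniz, D.leibniz_pow, hr, hx]
    simp [derivative_X_pow]
    ring

lemma coeff_derivation (hx : D (C X) = X) (hy : D X = C a * X ^ 2 + C b) (f : K[X][X]) (k : ℕ) :
    (D f).coeff k = derivative ((X * f).coeff k) + ((k : K[X]) - 1) * a * (X * f).coeff k +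
      ((k : K[X]) + 1) * b * f.coeff (k + 1) := by
  induction f using Polynomial.induction_on' with
  | add p q hp hq =>
    simp only [map_add, mul_add, coeff_add, hp, hq]
    ring
  | monomial n r =>
    have hD : D (monomial n r) = monomial (n + 1) (derivative r) + monomial (n + 1) (n * a * r) +
        monomial (n - 1) (n * b * r) := by
      simp only [← C_mul_X_pow_eq_monomial]
      rw [D.leibniz, D.leibniz_pow, derivation_C_eq hx, hy]
      rcases n with _ | n
      · simp
      · simp
        ring
    rw [hD, X_mul_monomial]
    simp only [coeff_add, coeff_monomial]
    rcases n with _ | n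
    · rcases k with _ | _ | k
      · simp
      · simp
      · simp
    · rcases eq_or_ne k (n + 2) with rfl | h1
      · simp
        exact Or.inl (Or.inl (by ring))
      · rcases eq_or_ne k n with rfl | h2
        · simp [h1.symm]
        · simp [h1.symm, h2.symm]

/-- The derivation has no nontrivial Darboux polynomial. -/
lemma isUnit_of_isPrimitive_of_dvd_derivation [CharZero K] {b : K}
    (hx : D (C X) = X) (hy : D X = C a * X ^ 2 + C (C b)) (hb : b ≠ 0) (ha : 1 ≤ a.natDegree)
    {f : K[X][X]} (hf : f.IsPrimitive) (hdvd : f ∣ D f) : IsUnit f := by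
  obtain ⟨q, hq⟩ := hdvd
  have hf0 : f ≠ 0 := hf.ne_zero
  have hcoeff := coeff_derivation hx hy f
  set n := f.natDegree with hn
  by_cases hn0 : n = 0
  · obtain ⟨r, hr⟩ := natDegree_eq_zero.mp hn0
    rw [← hr, isUnit_C]
    exact hf r (by rw [hr])
  have hfn : ∀ k, n < k → f.coeff k = 0 := fun k hk => coeff_eq_zero_of_natDegree_lt hk
  have hqd : q.natDegree ≤ 1 := by
    by_cases hq0 : q = 0
    · simp [hq0]
    have h1 : (D f).natDegree ≤ n + 1 := by
      rw [natDegree_le_iff_coeff_eq_zero]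
      intro k hk
      obtain ⟨k, rfl⟩ : ∃ m, k = m + 1 := ⟨k - 1, by omega⟩
      rw [hcoeff, coeff_X_mul, hfn k (by omega), hfn (k + 1 + 1) (by omega)]
      simp
    rw [hq, natDegree_mul hf0 hq0] at h1
    omega
  obtain ⟨l₁, l₀, rfl⟩ := exists_eq_X_add_C_of_natDegree_le_one hqd
  have hrec : ∀ k, l₁ * (X * f).coeff k + l₀ * f.coeff k =
      derivative ((X * f).coeff k) + ((k : K[X]) - 1) * a * (X * f).coeff k +
      ((k : K[X]) + 1) * C b * f.coeff (k + 1) := by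
    intro k
    rw [← hcoeff, hq, show f * (C l₁ * X + C l₀) = C l₁ * (X * f) + C l₀ * f by ring]
    simp
  have hlc0 : f.coeff n ≠ 0 := by simpa [hn] using hf0
  have htop := hrec (n + 1)
  rw [coeff_X_mul, hfn (n + 1) (by omega), hfn (n + 1 + 1) (by omega)] at htop
  push_cast at htop
  have hlc : derivative (f.coeff n) = 0 := by
    rw [← dvd_derivative_iff]
    exact ⟨l₁ - n * a, by linear_combination -htop⟩
  have hl₁ : l₁ = n * a := by
    apply mul_right_cancel₀ hlc0
    rw [hlc] at htop
    linear_combination htop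
  exfalso
  refine ne_zero_of_derivative_recurrence (N := n) (l := l₀)
    (g := fun j => (X * f).coeff (n + 1 - j)) (c := fun j => (n - j) * b) ha ?_ ?_ ?_ ?_ ?_
    (Nat.pos_of_ne_zero hn0) ?_
  · simpa using ⟨hn0, hb⟩
  · simpa using hlc0
  · simpa using derivative_eq_zero.mp hlc
  · have h := hrec n
    rw [hfn (n + 1) (by omega), hl₁] at h
    simp only [Nat.add_sub_cancel, Nat.sub_zero, coeff_X_mul]
    linear_combination -h
  · intro j hj
    obtain ⟨k, hk⟩ := Nat.exists_eq_add_of_le (Nat.succ_le_of_lt hj)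
    have h := hrec k
    have hnk : (n : K[X]) = j + 1 + k := by rw [hk]; push_cast; ring
    have hnk' : (n : K) - j = k + 1 := by rw [hk]; push_cast; ring
    rw [hl₁, hnk] at h
    rw [show n + 1 - (j + 2) = k by omega, show n + 1 - j = k + 1 + 1 by omega,
      show n + 1 - (j + 1) = k + 1 by omega, coeff_X_mul, coeff_X_mul, hnk']
    push_cast
    simp only [C_mul, C_add, C_1, map_natCast]
    linear_combination -h
  · simp

lemma C_mem_of_pow_mul_mem [CharZero K] (hx : D (C X) = X) (hy : D X = C a * X ^ 2 + C b)
    {I : Ideal K[X][X]} (hI : ∀ f ∈ I, D f ∈ I) {p : K[X]} (hp : p ≠ 0) {k : ℕ}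
    (h : C p * X ^ k ∈ I) : ∃ m : ℕ, X ^ m ∈ I := by
  induction hn : p.natDegree generalizing p k with
  | zero =>
    obtain ⟨r, rfl⟩ := natDegree_eq_zero.mp hn
    refine ⟨k, ?_⟩
    have hr : r ≠ 0 := by simpa using hp
    have := I.mul_mem_left (C (C r⁻¹)) h
    rwa [← mul_assoc, ← C_mul, ← C_mul, inv_mul_cancel₀ hr, C_1, C_1, one_mul] at this
  | succ n ih =>
    have hp' : (derivative p).natDegree = n := by rw [natDegree_derivative, hn]; rfl
    have hne : derivative p ≠ 0 := by
      intro h0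
      have := derivative_eq_zero.mp h0
      omega
    refine ih hne (k := k + 2) ?_ hp'
    have h1 := I.mul_mem_left X (hI _ h)
    have h2 := I.mul_mem_left ((k : K[X][X]) * (C a * X ^ 2 + C b)) h
    have := I.sub_mem h1 h2
    convert this using 1
    rw [D.leibniz, D.leibniz_pow, derivation_C_eq hx, hy]
    rcases k with _ | k
    · simp
      ring
    · simp
      ring

lemma eq_top_of_X_pow_mem [CharZero K] {b : K} (hb : b ≠ 0) (hy : D X = C a * X ^ 2 + C (C b))
    {I : Ideal K[X][X]} (hI : ∀ f ∈ I, D f ∈ I) {m : ℕ} (h : X ^ m ∈ I) : I = ⊤ := by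
  induction m with
  | zero => exact (Ideal.eq_top_iff_one I).mpr (by simpa using h)
  | succ m ih =>
    apply ih
    have h1 := I.sub_mem (hI _ h) (I.mul_mem_left (((m + 1 : ℕ) : K[X][X]) * C a * X) h)
    have hu : (((m + 1 : ℕ) : K) * b) ≠ 0 := mul_ne_zero (by exact_mod_cast m.succ_ne_zero) hb
    have h2 := I.mul_mem_left (C (C (((m + 1 : ℕ) : K) * b)⁻¹)) h1
    convert h2 using 1
    have e : D (X ^ (m + 1)) - ((m + 1 : ℕ) : K[X][X]) * C a * X * X ^ (m + 1) =
        C (C (((m + 1 : ℕ) : K) * b)) * X ^ m := by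
      rw [D.leibniz_pow, hy]
      simp
      ring
    rw [e, ← mul_assoc, ← C_mul, ← C_mul, inv_mul_cancel₀ hu, C_1, C_1, one_mul]

lemma derivation_isSimple [CharZero K] {b : K} (hb : b ≠ 0) (ha : 1 ≤ a.natDegree)
    (hx : D (C X) = X) (hy : D X = C a * X ^ 2 + C (C b)) : D.IsSimple := by
  classical
  intro I hI
  refine or_iff_not_imp_left.mpr fun hbot => ?_
  let _ : NormalizedGCDMonoid K[X] := Nonempty.some inferInstance
  obtain ⟨c, f, hc, hf, hcf, hdvd⟩ := exists_isPrimitive_dvd_of_ideal_ne_bot hbot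
  have hDf : f ∣ D f := by
    refine hf.dvd_of_dvd_C_mul hc ?_
    have := hdvd _ (hI _ hcf)
    rw [D.leibniz, smul_eq_mul, smul_eq_mul] at this
    exact (dvd_add_left (dvd_mul_right _ _)).mp this
  obtain ⟨u, rfl⟩ := isUnit_of_isPrimitive_of_dvd_derivation hx hy hb ha hf hDf
  rw [Ideal.mul_unit_mem_iff_mem I u.isUnit] at hcf
  obtain ⟨m, hm⟩ := C_mem_of_pow_mul_mem hx hy hI hc (k := 0) (by simpa using hcf)
  exact eq_top_of_X_pow_mem hb hy hI hm

lemma isUnit_of_derivation_isSimple (hx : D (C X) = X) (hy : D X = C a * X ^ 2 + C b)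
    (hD : D.IsSimple) : IsUnit b := by
  have hs : ∀ f ∈ ({X, C b} : Set K[X][X]), D f ∈ Ideal.span {X, C b} := by
    rintro _ (rfl | rfl)
    · rw [hy, Ideal.mem_span_pair]
      exact ⟨C a * X, 1, by ring⟩
    · rw [derivation_C_eq hx, Ideal.mem_span_pair]
      exact ⟨C (derivative b), 0, by ring⟩
  rcases hD (Ideal.span {X, C b}) (D.mem_span_of_forall_mem_span hs) with h | h
  · have : (X : K[X][X]) ∈ Ideal.span {X, C b} := Ideal.subset_span (by simp)
    rw [h] at this
    exact absurd this X_ne_zero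
  · rw [Ideal.eq_top_iff_one, Ideal.mem_span_pair] at h
    obtain ⟨u, v, huv⟩ := h
    have := congrArg (coeff · 0) huv
    simp only [coeff_add, mul_coeff_zero, coeff_X_zero, coeff_C_zero, coeff_one_zero, mul_zero,
      zero_add] at this
    exact IsUnit.of_mul_eq_one_right _ this

lemma one_le_natDegree_of_derivation_isSimple {b : K} (hx : D (C X) = X)
    (hy : D X = C a * X ^ 2 + C (C b)) (hD : D.IsSimple) : 1 ≤ a.natDegree := by
  by_contra! hlt
  obtain ⟨c, rfl⟩ := natDegree_eq_zero.mp (Nat.lt_one_iff.mp hlt)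
  suffices ∃ f : K[X][X], f.natDegree = 2 ∧ f ∣ D f by
    obtain ⟨f, hf2, hf⟩ := this
    rcases hD.eq_zero_or_isUnit_of_dvd hf with rfl | h
    · simp at hf2
    · simp [natDegree_eq_zero_of_isUnit h] at hf2
  have hC : ∀ r : K, D (C (C r)) = 0 := fun r => D.map_algebraMap r
  by_cases hc : c = 0
  · subst hc
    refine ⟨X ^ 2 - C (C (2 * b) * X), by compute_degree!, ?_⟩
    have : D (X ^ 2 - C (C (2 * b) * X)) = 0 := by
      rw [map_sub, C_mul, D.leibniz, D.leibniz_pow, hC, hx, hy]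
      simp [C_ofNat]
      ring
    rw [this]
    exact dvd_zero _
  · refine ⟨C (C c) * X ^ 2 + C (C b), by compute_degree!, 2 * C (C c) * X, ?_⟩
    rw [map_add, D.leibniz, D.leibniz_pow, hC, hC, hy]
    simp
    ring

lemma derivation_isSimple_iff [CharZero K] (hx : D (C X) = X) (hy : D X = C a * X ^ 2 + C b) :
    D.IsSimple ↔ b.degree = 0 ∧ 1 ≤ a.degree := by
  have hdeg : 1 ≤ a.degree ↔ 1 ≤ a.natDegree := by
    rw [Nat.one_le_iff_ne_zero, ← Nat.pos_iff_ne_zero, natDegree_pos_iff_degree_pos]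
    exact (Nat.WithBot.one_le_iff_zero_lt)
  rw [hdeg, ← isUnit_iff_degree_eq_zero]
  constructor
  · intro h
    have hb := isUnit_of_derivation_isSimple hx hy h
    obtain ⟨r, -, rfl⟩ := isUnit_iff.mp hb
    exact ⟨hb, one_le_natDegree_of_derivation_isSimple hx hy h⟩
  · rintro ⟨hb, ha⟩
    obtain ⟨r, hr, rfl⟩ := isUnit_iff.mp hb
    exact derivation_isSimple hr.ne_zero ha hx hy

end Bivariate

end Polynomial

theorem stmt_0 (K : Type*) [Field K] [CharZero K] (a2 a0 : Polynomial K)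
    (D : Derivation K (MvPolynomial (Fin 2) K) (MvPolynomial (Fin 2) K))
    (hDx : D (MvPolynomial.X 0) = MvPolynomial.X 1)
    (hDy : D (MvPolynomial.X 1) =
      Polynomial.aeval (MvPolynomial.X 0) a2 * MvPolynomial.X 1 ^ 2 +
        Polynomial.aeval (MvPolynomial.X 0) a0) :
    D.IsSimple ↔ a0.degree = 0 ∧ 1 ≤ a2.degree := by
  set e := (Polynomial.Bivariate.equivMvPolynomial K).symm with he
  have haeval : ∀ p : K[X], e (aeval (MvPolynomial.X 0) p) = C p := by
    intro p
    rw [← Polynomial.aeval_algHom_apply e, he, Polynomial.Bivariate.equivMvPolynomial_symm_X_0]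
    exact (Polynomial.aeval_algHom_apply (CAlgHom (R := K) (A := K[X])) X p).trans (by simp)
  rw [← D.isSimple_conj_iff e]
  refine derivation_isSimple_iff ?_ ?_
  · simp [Derivation.conj_apply, he, hDx]
  · rw [Derivation.conj_apply, he, AlgEquiv.symm_symm,
      Polynomial.Bivariate.equivMvPolynomial_X, hDy, ← he]
    simp only [map_add, map_mul, map_pow, haeval]
    simp [he]
end

section
/- Let K be a field of characteristic zero, let a1(x), a0(x) ∈ K[x], and let D = y∂x + (a1(x)y + a0(x))∂y be the K-derivation of K[x,y] determined by D(x) = y and D(y) = a1(x)y + a0(x). If D is simple, then the image Im D = D(K[x,y]) is not a Mathieu-Zhao space of K[x,y]. -/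
/-- A `K`-subspace `M` of `R` is a *Mathieu-Zhao space* if whenever `a ∈ R`
satisfies `a ^ m ∈ M` for all sufficiently large `m`, then for every `b ∈ R`
one has `b * a ^ m ∈ M` for all sufficiently large `m`. -/
def Submodule.IsMathieuZhao {K R : Type*} [CommRing K] [CommRing R] [Algebra K R]
    (M : Submodule K R) : Prop :=
  ∀ a : R, (∃ N : ℕ, ∀ m : ℕ, N ≤ m → a ^ m ∈ M) →
    ∀ b : R, ∃ N : ℕ, ∀ m : ℕ, N ≤ m → b * a ^ m ∈ M

/-- An ideal generated by `S` is `D`-stable as soon as `D` maps `S` into it. -/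
lemma Derivation.map_mem_span {K R : Type*} [CommRing K] [CommRing R] [Algebra K R]
    (D : Derivation K R R) (S : Set R) (hS : ∀ s ∈ S, D s ∈ Ideal.span S) :
    ∀ a ∈ Ideal.span S, D a ∈ Ideal.span S := by
  intro a ha
  induction ha using Submodule.span_induction with
  | mem x hx => exact hS x hx
  | zero => simp
  | add x y _ _ hx hy => simpa using add_mem hx hy
  | smul r x hx hDx =>
    rw [smul_eq_mul, D.leibniz]
    exact add_mem (Ideal.mul_mem_left _ _ hDx) (by
      rw [smul_eq_mul]; exact Ideal.mul_mem_right _ _ hx)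

/-- A simple derivation has no nontrivial Darboux elements. -/
lemma Derivation.IsSimple.isUnit_of_dvd {K R : Type*} [CommRing K] [CommRing R] [Algebra K R]
    {D : Derivation K R R} (hD : D.IsSimple) {u : R} (hu : u ≠ 0) (h : u ∣ D u) : IsUnit u := by
  have hstable := D.map_mem_span {u} (by
    rintro s rfl
    exact Ideal.mem_span_singleton.2 h)
  rcases hD _ hstable with h0 | h1
  · exact absurd (Ideal.span_singleton_eq_bot.1 h0) hu
  · exact Ideal.span_singleton_eq_top.1 h1

/-- A Mathieu-Zhao space containing `1` is the whole ring. -/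
lemma Submodule.IsMathieuZhao.eq_top_of_one_mem {K R : Type*} [CommRing K] [CommRing R]
    [Algebra K R] {M : Submodule K R} (hM : M.IsMathieuZhao) (h1 : (1 : R) ∈ M) : M = ⊤ := by
  refine eq_top_iff.2 fun b _ => ?_
  obtain ⟨N, hN⟩ := hM 1 ⟨0, fun m _ => by simpa using h1⟩ b
  simpa using hN N le_rfl

namespace Polynomial

lemma exists_derivative_eq {K : Type*} [Field K] [CharZero K] (p : K[X]) :
    ∃ q : K[X], derivative q = p := by
  induction p using Polynomial.induction_on' with
  | add p q hp hq =>
    obtain ⟨a, rfl⟩ := hp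
    obtain ⟨b, rfl⟩ := hq
    exact ⟨a + b, by simp⟩
  | monomial n a =>
    refine ⟨monomial (n + 1) (a / (n + 1)), ?_⟩
    have : (n : K) + 1 ≠ 0 := by exact_mod_cast n.succ_ne_zero
    rw [derivative_monomial]
    congr 1
    push_cast
    field_simp

/-- Degrees of the `y`-coefficients of an element that `y∂x + (ay + c)∂y` maps into `K[x]`. -/
lemma natDegree_of_derivative_recurrence {K : Type*} [Field K] [CharZero K] {a : K[X]}
    (ha : a.natDegree ≠ 0) (c : K) (F : ℕ → K[X]) (n : ℕ) (hn : F n ≠ 0)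
    (hgt : ∀ k, n < k → F k = 0)
    (hF : ∀ k, derivative (F k) + (k + 1 : K[X]) * (a * F (k + 1)) +
      (k + 2 : K[X]) * (C c * F (k + 2)) = 0) :
    ∀ j k, k + j = n → F k ≠ 0 ∧ (F k).natDegree = j * (a.natDegree + 1) ∧
      (F (k + 1)).natDegree ≤ j * (a.natDegree + 1) := by
  intro j
  induction j with
  | zero =>
    rintro k rfl
    have h := hF k
    rw [hgt (k + 1) (by lia), hgt (k + 2) (by lia)] at h
    refine ⟨hn, ?_, by simp [hgt]⟩
    simpa using h
  | succ j ih =>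
    intro k hk
    obtain ⟨h0, h1, h2⟩ := ih (k + 1) (by lia)
    have ha0 : a ≠ 0 := by rintro rfl; simp at ha
    have hk1 : (k + 1 : K) ≠ 0 := by exact_mod_cast k.succ_ne_zero
    have e1 : ((k + 1 : K[X]) * (a * F (k + 1))).natDegree
        = j * (a.natDegree + 1) + a.natDegree := by
      rw [show (k + 1 : K[X]) = C (k + 1 : K) by simp, natDegree_C_mul hk1,
        natDegree_mul ha0 h0, h1, add_comm]
    have e2 : ((k + 2 : K[X]) * (C c * F (k + 2))).natDegree ≤ j * (a.natDegree + 1) := by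
      rw [show (k + 2 : K[X]) = C (k + 2 : K) by simp [C_ofNat]]
      exact (natDegree_C_mul_le _ _).trans ((natDegree_C_mul_le _ _).trans h2)
    have e3 : (derivative (F k)).natDegree = j * (a.natDegree + 1) + a.natDegree := by
      have h : derivative (F k) = -((k + 1 : K[X]) * (a * F (k + 1)) +
          (k + 2 : K[X]) * (C c * F (k + 2))) := by linear_combination hF k
      rw [h, natDegree_neg, natDegree_add_eq_left_of_natDegree_lt (by lia), e1]
    rw [natDegree_derivative] at e3
    have hd : (F k).natDegree = (j + 1) * (a.natDegree + 1) := by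
      rw [add_mul, one_mul]; lia
    refine ⟨?_, hd, ?_⟩
    · intro h
      rw [h, natDegree_zero] at hd
      have : 0 < (j + 1) * (a.natDegree + 1) := by positivity
      lia
    · rw [h1, add_mul]; lia

/-- The derivation `y∂x + (a(x)y + b(x))∂y` of `K[x][y]`. -/
noncomputable def quadraticDerivation {K : Type*} [Field K] (a b : K[X]) :
    Derivation K K[X][X] K[X][X] :=
  (X : K[X][X]) • PolynomialModule.equivPolynomialSelf.compDer
      (derivative' : Derivation K K[X] K[X]).mapCoeffs +
    (C a * X + C b) • (derivative' : Derivation K[X] K[X][X] K[X][X]).restrictScalars K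

lemma quadraticDerivation_apply {K : Type*} [Field K] (a b : K[X]) (F : K[X][X]) :
    quadraticDerivation a b F = X * PolynomialModule.equivPolynomialSelf
      ((derivative' : Derivation K K[X] K[X]).mapCoeffs F) +
      (C a * X + C b) * derivative F := rfl

lemma coeff_quadraticDerivation_zero {K : Type*} [Field K] (a b : K[X]) (F : K[X][X]) :
    (quadraticDerivation a b F).coeff 0 = b * F.coeff 1 := by
  simp [quadraticDerivation_apply, mul_coeff_zero, coeff_derivative]

lemma coeff_quadraticDerivation_succ {K : Type*} [Field K] (a b : K[X]) (F : K[X][X]) (k : ℕ) :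
    (quadraticDerivation a b F).coeff (k + 1) = derivative (F.coeff k) +
      (k + 1 : K[X]) * (a * F.coeff (k + 1)) + (k + 2 : K[X]) * (b * F.coeff (k + 2)) := by
  have h : (PolynomialModule.equivPolynomialSelf
      ((derivative' : Derivation K K[X] K[X]).mapCoeffs F)).coeff k = derivative (F.coeff k) := rfl
  rw [quadraticDerivation_apply, coeff_add, coeff_X_mul, h, add_mul, coeff_add, mul_assoc,
    coeff_C_mul, coeff_C_mul, coeff_X_mul, coeff_derivative, coeff_derivative]
  push_cast
  ring

lemma quadraticDerivation_C {K : Type*} [Field K] (a b p : K[X]) :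
    quadraticDerivation a b (C p) = C (derivative p) * X := by
  ext1 k
  cases k with
  | zero => simp [coeff_quadraticDerivation_zero]
  | succ k => simp [coeff_quadraticDerivation_succ, coeff_C, apply_ite derivative]

lemma quadraticDerivation_X {K : Type*} [Field K] (a b : K[X]) :
    quadraticDerivation a b X = C a * X + C b := by
  ext1 k
  cases k with
  | zero => simp [coeff_quadraticDerivation_zero]
  | succ k =>
    rcases k with _ | k <;>
      simp [coeff_quadraticDerivation_succ, coeff_X, coeff_C, apply_ite derivative]

lemma quadraticDerivation_ne_C_X {K : Type*} [Field K] [CharZero K] {a : K[X]}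
    (ha : a.natDegree ≠ 0) (c : K) (F : K[X][X]) :
    quadraticDerivation a (C c) F ≠ C X := by
  intro h
  have h0 : C c * F.coeff 1 = X := by
    rw [← coeff_quadraticDerivation_zero a, h, coeff_C_zero]
  have hF1 : F.coeff 1 ≠ 0 := by
    intro h1
    rw [h1, mul_zero] at h0
    exact X_ne_zero h0.symm
  have hc : c ≠ 0 := by
    rintro rfl
    rw [C_0, zero_mul] at h0
    exact X_ne_zero h0.symm
  have hF : F ≠ 0 := by rintro rfl; simp at hF1
  obtain ⟨j, hj⟩ : ∃ j, 1 + j = F.natDegree :=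
    ⟨F.natDegree - 1, by have := le_natDegree_of_ne_zero hF1; lia⟩
  obtain ⟨-, hdeg, -⟩ := natDegree_of_derivative_recurrence ha c F.coeff F.natDegree
    (by simpa using hF) (fun k hk => coeff_eq_zero_of_natDegree_lt hk)
    (fun k => by rw [← coeff_quadraticDerivation_succ, h, coeff_C_succ]) j 1 hj
  have hX := congrArg natDegree h0
  rw [natDegree_C_mul hc, hdeg, natDegree_X] at hX
  have := Nat.eq_one_of_mul_eq_one_left hX
  lia

end Polynomial

namespace MvPolynomial

/-- Viewing `K[x, y]` as `K[x][y]` turns `D` into `Polynomial.quadraticDerivation`. -/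
lemma aeval_derivation_eq_quadraticDerivation {K : Type*} [Field K] {a b : Polynomial K}
    {D : Derivation K (MvPolynomial (Fin 2) K) (MvPolynomial (Fin 2) K)}
    (hDx : D (X 0) = X 1)
    (hDy : D (X 1) = Polynomial.aeval (X 0) a * X 1 + Polynomial.aeval (X 0) b)
    (f : MvPolynomial (Fin 2) K) :
    aeval ![Polynomial.C (Polynomial.X : Polynomial K), Polynomial.X] (D f) =
      Polynomial.quadraticDerivation a b
        (aeval ![Polynomial.C (Polynomial.X : Polynomial K), Polynomial.X] f) := by
  have hC (p : Polynomial K) : Polynomial.aeval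
      (Polynomial.C Polynomial.X : Polynomial (Polynomial K)) p = Polynomial.C p := by
    rw [← Polynomial.algebraMap_eq, Polynomial.aeval_algebraMap_apply,
      Polynomial.aeval_X_left_apply]
  induction f using MvPolynomial.induction_on with
  | C r =>
    rw [← algebraMap_eq, D.map_algebraMap, AlgHom.commutes, Derivation.map_algebraMap, map_zero]
  | add p q hp hq => simp only [map_add, hp, hq]
  | mul_X p i hp =>
    have hi : aeval ![Polynomial.C (Polynomial.X : Polynomial K), Polynomial.X] (D (X i)) =
        Polynomial.quadraticDerivation a b
          ((![Polynomial.C Polynomial.X, Polynomial.X] : Fin 2 → Polynomial (Polynomial K)) i) := by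
      fin_cases i
      · simp [hDx, Polynomial.quadraticDerivation_C]
      · simp [hDy, Polynomial.quadraticDerivation_X, ← Polynomial.aeval_algHom_apply, hC]
    simp only [Derivation.leibniz, map_add, map_mul, smul_eq_mul, hp, hi, aeval_X]

/-- If `D` is simple then `b` is a nonzero constant. -/
lemma exists_eq_C_of_isSimple {K : Type*} [Field K] {a b : Polynomial K}
    {D : Derivation K (MvPolynomial (Fin 2) K) (MvPolynomial (Fin 2) K)}
    (hDx : D (X 0) = X 1)
    (hDy : D (X 1) = Polynomial.aeval (X 0) a * X 1 + Polynomial.aeval (X 0) b)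
    (hD : D.IsSimple) : ∃ c : K, c ≠ 0 ∧ b = Polynomial.C c := by
  set I : Ideal (MvPolynomial (Fin 2) K) := Ideal.span {X 1, Polynomial.aeval (X 0) b} with hI
  have hX : X 1 ∈ I := Ideal.subset_span (by simp)
  have hb : Polynomial.aeval (X 0) b ∈ I := Ideal.subset_span (by simp)
  have hstable : ∀ f ∈ I, D f ∈ I := D.map_mem_span _ (by
    rintro s (rfl | rfl)
    · rw [hDy]
      exact add_mem (Ideal.mul_mem_left _ _ hX) hb
    · rw [D.map_aeval, hDx]
      exact Ideal.mul_mem_left _ _ hX)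
  have htop : I = ⊤ := (hD I hstable).resolve_left fun h => by
    rw [h, Ideal.mem_bot] at hX
    exact X_ne_zero _ hX
  obtain ⟨u, v, huv⟩ := Ideal.mem_span_pair.1 ((Ideal.eq_top_iff_one _).1 htop)
  have hmap := congrArg (aeval ![(Polynomial.X : Polynomial K), 0]) huv
  simp only [map_add, map_mul, aeval_X, map_one, ← Polynomial.aeval_algHom_apply,
    Matrix.cons_val_zero, Matrix.cons_val_one, mul_zero, zero_add,
    Polynomial.aeval_X_left_apply] at hmap
  obtain ⟨c, hc, hcb⟩ := Polynomial.isUnit_iff.1 (IsUnit.of_mul_eq_one_right _ hmap)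
  exact ⟨c, hc.ne_zero, hcb.symm⟩

/-- If `D` is simple then `a` is not constant. -/
lemma natDegree_ne_zero_of_isSimple {K : Type*} [Field K] {a : Polynomial K} {c : K}
    (hc : c ≠ 0)
    {D : Derivation K (MvPolynomial (Fin 2) K) (MvPolynomial (Fin 2) K)}
    (hDx : D (X 0) = X 1) (hDy : D (X 1) = Polynomial.aeval (X 0) a * X 1 + C c)
    (hD : D.IsSimple) : a.natDegree ≠ 0 := by
  intro h
  obtain ⟨r, rfl⟩ := Polynomial.natDegree_eq_zero.1 h
  rw [Polynomial.aeval_C, algebraMap_eq] at hDy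
  have hDC (s : K) : D (C s) = 0 := D.map_algebraMap s
  by_cases hr : r = 0
  · subst hr
    rw [C_0, zero_mul, zero_add] at hDy
    have hu : (X 1 ^ 2 - C (c + c) * X 0 : MvPolynomial (Fin 2) K) ≠ 0 := fun h0 => by
      simpa using congrArg (eval ![(0 : K), 1]) h0
    have := (hD.isUnit_of_dvd hu (by
      have : D (X 1 ^ 2 - C (c + c) * X 0 : MvPolynomial (Fin 2) K) = 0 := by
        simp only [map_sub, Derivation.leibniz, Derivation.leibniz_pow, hDx, hDy, hDC (c + c),
          smul_eq_mul, nsmul_eq_mul]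
        rw [C_add]
        push_cast
        ring
      rw [this]
      exact dvd_zero _)).map (eval ![(0 : K), 0])
    simp at this
  · have hu : (C r * X 1 + C c : MvPolynomial (Fin 2) K) ≠ 0 := fun h0 => hc (by
      simpa using congrArg (eval ![(0 : K), 0]) h0)
    have := (hD.isUnit_of_dvd hu ⟨C r, by
      simp only [map_add, Derivation.leibniz, hDy, hDC, smul_eq_mul]
      ring⟩).map (eval ![(0 : K), -(c / r)])
    simp [mul_div_cancel₀ _ hr] at this

end MvPolynomial

theorem stmt_1 (K : Type*) [Field K] [CharZero K] (a1 a0 : Polynomial K)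
    (D : Derivation K (MvPolynomial (Fin 2) K) (MvPolynomial (Fin 2) K))
    (hDx : D (MvPolynomial.X 0) = MvPolynomial.X 1)
    (hDy : D (MvPolynomial.X 1) =
      Polynomial.aeval (MvPolynomial.X 0) a1 * MvPolynomial.X 1 +
        Polynomial.aeval (MvPolynomial.X 0) a0)
    (hsimple : D.IsSimple) :
    ¬ (LinearMap.range D.toLinearMap).IsMathieuZhao := by
  intro hMZ
  obtain ⟨c, hc, rfl⟩ := MvPolynomial.exists_eq_C_of_isSimple hDx hDy hsimple
  have hdeg : a1.natDegree ≠ 0 :=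
    MvPolynomial.natDegree_ne_zero_of_isSimple hc hDx (by simpa using hDy) hsimple
  obtain ⟨A, rfl⟩ := Polynomial.exists_derivative_eq a1
  have h1 : (1 : MvPolynomial (Fin 2) K) ∈ LinearMap.range D.toLinearMap := by
    refine ⟨c⁻¹ • (MvPolynomial.X 1 - Polynomial.aeval (MvPolynomial.X 0) A), ?_⟩
    rw [Derivation.coeFn_coe, D.map_smul, map_sub, D.map_aeval,
      hDx, hDy, smul_eq_mul, add_sub_cancel_left, ← map_smul, Polynomial.smul_C, smul_eq_mul,
      inv_mul_cancel₀ hc, map_one, map_one]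
  obtain ⟨f, hf⟩ : MvPolynomial.X 0 ∈ LinearMap.range D.toLinearMap :=
    hMZ.eq_top_of_one_mem h1 ▸ Submodule.mem_top
  refine Polynomial.quadraticDerivation_ne_C_X hdeg c
    (MvPolynomial.aeval ![Polynomial.C (Polynomial.X : Polynomial K), Polynomial.X] f) ?_
  rw [← MvPolynomial.aeval_derivation_eq_quadraticDerivation hDx hDy]
  have hf' : D f = MvPolynomial.X 0 := hf
  simp [hf']
end

section
/- Let K be a field of characteristic zero, let a1(x) ∈ K[x], a0 ∈ K, and let D = y∂x + (a1(x)y + a0)∂y be the K-derivation of K[x,y] determined by D(x) = y and D(y) = a1(x)y + a0. Then D is simple if and only if the image Im D = D(K[x,y]) is not a Mathieu-Zhao space of K[x,y]. -/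
open Polynomial

theorem degree_eq_of_degree_derivative_eq {K : Type*} [Field K] [CharZero K] {h : K[X]} {n : ℕ}
    (hn : (derivative h).degree = (n : ℕ)) : h.degree = ((n + 1 : ℕ) : WithBot ℕ) := by
  have h0 : h.natDegree ≠ 0 := by
    rw [← derivative_ne_zero]
    intro h0
    simp [h0] at hn
  rw [degree_derivative h0] at hn
  have hh : h ≠ 0 := by rintro rfl; simp at h0
  rw [degree_eq_natDegree hh]
  norm_cast at hn ⊢
  omega

theorem degree_of_descending_recurrence {K : Type*} [Field K] [CharZero K] {g μ : ℕ → K[X]}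
    {a0 c : K} {k m r : ℕ} (hc : c ≠ 0) (hm : g m = C c) (hm1 : g (m + 1) = 0)
    (hrec : ∀ j, k ≤ j → j < m →
      derivative (g j) + C (a0 * (j + 2)) * g (j + 2) = μ (j + 1) * g (j + 1))
    (hμ : ∀ j, k < j → j ≤ m → (μ j).degree = (r : ℕ)) :
    ∀ i j, j + i = m → k ≤ j → (g j).degree = ((i * (r + 1) : ℕ) : WithBot ℕ) ∧
      (g (j + 1)).degree < ((i * (r + 1) : ℕ) : WithBot ℕ) := by
  intro i
  induction i with
  | zero =>
    rintro j rfl -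
    rw [add_zero] at hm hm1
    rw [hm, hm1, degree_C hc]
    simp
  | succ i ih =>
    intro j hj hk
    obtain ⟨h1, h2⟩ := ih (j + 1) (by omega) (by omega)
    refine ⟨?_, ?_⟩
    · have hd : (derivative (g j)).degree = ((i * (r + 1) + r : ℕ) : WithBot ℕ) := by
        have hlt : (C (a0 * (j + 2)) * g (j + 2)).degree < (μ (j + 1) * g (j + 1)).degree := by
          rw [degree_mul (p := μ _), hμ _ (by omega) (by omega), h1]
          rw [← smul_eq_C_mul]
          refine (degree_smul_le _ _).trans_lt (h2.trans_le ?_)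
          norm_cast
          omega
        rw [eq_sub_of_add_eq (hrec j hk (by omega)), degree_sub_eq_left_of_degree_lt hlt, degree_mul,
          hμ _ (by omega) (by omega), h1]
        norm_cast
        omega
      rw [degree_eq_of_degree_derivative_eq hd]
      congr 1
      ring
    · rw [h1]
      norm_cast
      nlinarith

theorem degree_of_ascending_recurrence {K : Type*} [Field K] [CharZero K] {g μ : ℕ → K[X]} {a0 : K}
    {k d e : ℕ} (h0 : a0 ≠ 0) (hd : (g 0).degree = (d : ℕ)) (he : 0 < e)
    (hzero : C a0 * g 1 = μ 0 * g 0)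
    (hrec : ∀ j, j + 1 < k →
      derivative (g j) + C (a0 * (j + 2)) * g (j + 2) = μ (j + 1) * g (j + 1))
    (hμ : ∀ j, j < k → (μ j).degree = (e : ℕ)) :
    ∀ j, j < k → (g j).degree = ((d + j * e : ℕ) : WithBot ℕ) ∧
      (g (j + 1)).degree = ((d + (j + 1) * e : ℕ) : WithBot ℕ) := by
  intro j
  induction j with
  | zero =>
    intro hk
    refine ⟨by simpa using hd, ?_⟩
    have := congrArg degree hzero
    rw [degree_C_mul h0, degree_mul, hμ 0 hk, hd] at this
    rw [this]
    norm_cast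
    omega
  | succ j ih =>
    intro hk
    obtain ⟨h1, h2⟩ := ih (by omega)
    refine ⟨h2, ?_⟩
    have hlt : (derivative (g j)).degree < (μ (j + 1) * g (j + 1)).degree := by
      rw [degree_mul, hμ _ hk, h2]
      refine degree_derivative_le.trans_lt ?_
      rw [h1]
      norm_cast
      nlinarith
    have h3 : (a0 * (j + 2) : K) ≠ 0 := mul_ne_zero h0 (by exact_mod_cast (by omega : j + 2 ≠ 0))
    have := congrArg degree (eq_sub_of_add_eq' (hrec j hk))
    rw [degree_C_mul h3, degree_sub_eq_left_of_degree_lt hlt, degree_mul, hμ _ hk, h2] at this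
    rw [this]
    norm_cast
    ring

theorem exists_mul_derivative_add_mul_eq {K : Type*} [Field K] [CharZero K] {a : K} (ha : a ≠ 0) (b : K)
    (h : K[X]) : ∃ f : K[X], C a * derivative f + C b * f = h := by
  suffices H : (LinearMap.range (a • derivative + b • LinearMap.id : K[X] →ₗ[K] K[X])) = ⊤ by
    obtain ⟨f, hf⟩ := (LinearMap.range_eq_top.1 H) h
    exact ⟨f, by simpa [smul_eq_C_mul] using hf⟩
  rw [eq_top_iff, ← (Polynomial.basisMonomials K).span_eq, Submodule.span_le]
  rintro _ ⟨n, rfl⟩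
  simp only [coe_basisMonomials, SetLike.mem_coe]
  by_cases hb : b = 0
  · refine ⟨monomial (n + 1) (a * (n + 1))⁻¹, ?_⟩
    have : (n + 1 : K) ≠ 0 := by exact_mod_cast n.succ_ne_zero
    simp [hb, smul_monomial]
    field_simp
  · induction n with
    | zero => exact ⟨monomial 0 b⁻¹, by simp [hb]⟩
    | succ n ih =>
      have h1 : monomial (n + 1) (1 : K) = (a • derivative + b • LinearMap.id : K[X] →ₗ[K] K[X])
          (monomial (n + 1) b⁻¹) - (a * b⁻¹ * (n + 1)) • monomial n 1 := by
        simp [smul_monomial, hb]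
        ring_nf
      rw [h1]
      exact Submodule.sub_mem _ ⟨_, rfl⟩ (Submodule.smul_mem _ _ ih)

/-- The derivation of `K[t][X]` that differentiates every coefficient with respect to `t`. -/
noncomputable def coeffDerivative (K : Type*) [Field K] : Derivation K K[X][X] K[X][X] :=
  (PolynomialModule.equivPolynomialSelf (R := K[X])).toLinearMap.compDer derivative'.mapCoeffs

theorem coeff_coeffDerivative {K : Type*} [Field K] (p : K[X][X]) (n : ℕ) :
    (coeffDerivative K p).coeff n = derivative (p.coeff n) := rfl

theorem coeffDerivative_C {K : Type*} [Field K] (p : K[X]) :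
    coeffDerivative K (C p) = C (derivative p) := by
  ext n : 1
  rw [coeff_coeffDerivative, coeff_C, coeff_C]
  split_ifs <;> simp

theorem coeffDerivative_X {K : Type*} [Field K] : coeffDerivative K X = 0 := by
  ext n : 1
  rw [coeff_coeffDerivative, coeff_X]
  split_ifs <;> simp

theorem no_resonant_recurrence {K : Type*} [Field K] [CharZero K]
    {g μ : ℕ → K[X]} {a1 : K[X]} {a0 c : K} {m q : ℕ} (h0 : a0 ≠ 0) (h1 : 0 < a1.natDegree)
    (hc : c ≠ 0) (hm : g m = C c) (hm1 : g (m + 1) = 0) (hqm : q < m) (hg0 : g 0 ≠ 0)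
    (hzero : C a0 * g 1 = μ 0 * g 0)
    (hrec : ∀ j, j < m →
      derivative (g j) + C (a0 * (j + 2)) * g (j + 2) = μ (j + 1) * g (j + 1))
    (hμq : (μ (q + 1)).degree < (a1.natDegree : ℕ))
    (hμ : ∀ j, μ j = μ (q + 1) + C ((q : K) + 1 - j) * a1) : False := by
  have ha1 : a1 ≠ 0 := by rintro rfl; simp at h1
  have hdeg : ∀ j, j ≠ q + 1 → (μ j).degree = (a1.natDegree : ℕ) := by
    intro j hj
    have hj' : (q : K) + 1 - j ≠ 0 := sub_ne_zero.2 (by exact_mod_cast hj.symm)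
    rw [hμ j, degree_add_eq_right_of_degree_lt] <;> rw [degree_C_mul hj', degree_eq_natDegree ha1]
    exact hμq
  set e := a1.natDegree with he
  obtain ⟨d, hd⟩ : ∃ d : ℕ, (g 0).degree = d := ⟨_, degree_eq_natDegree hg0⟩
  have top := degree_of_descending_recurrence (k := q + 1) (r := e) (μ := μ) hc hm hm1
    (fun j _ hj => hrec j hj) (fun j hj _ => hdeg j (by omega))
  have bot := degree_of_ascending_recurrence (k := q + 1) h0 hd h1 hzero
    (fun j hj => hrec j (by omega)) (fun j hj => hdeg j (by omega))
  obtain ⟨b1, b2⟩ := bot q (by omega)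
  obtain ⟨i, rfl⟩ : ∃ i, m = q + 2 + i := by
    refine Nat.exists_eq_add_of_le (Nat.lt_of_le_of_ne hqm ?_)
    rintro rfl
    rw [hm, degree_C hc] at b2
    norm_cast at b2
    nlinarith
  obtain ⟨t1, t2⟩ := top i (q + 2) (by omega) (by omega)
  obtain ⟨t3, t4⟩ := top (i + 1) (q + 1) (by omega) (by omega)
  obtain ⟨n, hn⟩ : ∃ n, n = i * (e + 1) := ⟨_, rfl⟩
  rw [← hn] at t1 t2
  have hN : (i + 1) * (e + 1) = n + 1 + e := by rw [hn]; ring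
  rw [hN] at t3
  have hd' : d + q * e = n + 1 := by
    rw [b2] at t3
    norm_cast at t3
    nlinarith
  rw [hd'] at b1
  have hν : μ (q + 1) = 0 := by
    by_contra hν
    have h2 := congrArg degree (hrec q (by omega))
    rw [degree_mul, t3, degree_eq_natDegree hν] at h2
    have h3 : (derivative (g q) + C (a0 * (q + 2)) * g (q + 2)).degree
        ≤ ((n + 1 : ℕ) : WithBot ℕ) := by
      refine (degree_add_le _ _).trans (max_le (degree_derivative_le.trans b1.le) ?_)
      rw [← smul_eq_C_mul]
      refine (degree_smul_le _ _).trans ?_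
      rw [t1]
      norm_cast
      omega
    rw [h2] at h3
    norm_cast at h3
    omega
  have hγ : (g (q + 1)).coeff (n + 1 + e) ≠ 0 := coeff_ne_zero_of_eq_degree t3
  have e1 : (g q).coeff (n + 1) * (n + 1) + a0 * (q + 2) * (g (q + 2)).coeff n = 0 := by
    have := congrArg (coeff · n) (hrec q (by omega))
    simpa [hν, coeff_derivative, -map_add, -map_mul] using this
  have e2 : (g (q + 1)).coeff (n + 1 + e) * (n + 1 + e) = - (a1.coeff e * (g (q + 2)).coeff n) := by
    have := congrArg (coeff · (e + n)) (hrec (q + 1) (by omega))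
    simp only [hμ (q + 1 + 1), hν] at this
    rw [coeff_add, coeff_derivative, coeff_C_mul, zero_add, mul_assoc (C _) a1, coeff_C_mul,
      coeff_mul_add_eq_of_natDegree_le he.ge (natDegree_le_of_degree_le t1.le),
      coeff_eq_zero_of_degree_lt (p := g (q + 1 + 2))
        (t2.trans_le (by norm_cast; omega))] at this
    push_cast at this
    rw [show n + 1 + e = e + n + 1 by ring]
    linear_combination this
  have e3 : a0 * (q + 1) * (g (q + 1)).coeff (n + 1 + e) = a1.coeff e * (g q).coeff (n + 1) := by
    have key : C (a0 * (q + 1)) * g (q + 1) + (if q = 0 then 0 else derivative (g (q - 1)))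
        = a1 * g q := by
      rcases q with _ | q
      · simpa [hμ 0, hν] using hzero
      · have := hrec q (by omega)
        rw [hμ, hν] at this
        rw [if_neg (by omega), Nat.add_sub_cancel, add_comm]
        push_cast at this ⊢
        convert this using 2
        · ring_nf
        · simp
    have := congrArg (coeff · (e + (n + 1))) key
    have hz : (if q = 0 then 0 else derivative (g (q - 1))).coeff (e + (n + 1)) = 0 := by
      rcases q with _ | q
      · simp
      · rw [if_neg (by omega), Nat.add_sub_cancel]
        refine coeff_eq_zero_of_degree_lt ((degree_derivative_le).trans_lt ?_)
        rw [(bot q (by omega)).1]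
        norm_cast
        nlinarith
    rw [coeff_add, hz, add_zero, coeff_C_mul,
      coeff_mul_add_eq_of_natDegree_le he.ge (natDegree_le_of_degree_le b1.le)] at this
    rw [← this, show e + (n + 1) = n + 1 + e by ring]
  have e4 : a0 * (g (q + 1)).coeff (n + 1 + e) * (((n + 1 + e) + (q + 1) * e : ℕ) : K) = 0 := by
    push_cast
    linear_combination (-a1.coeff e) * e1 - (n + 1 : K) * e3 + (a0 * (q + 2)) * e2
  have : (((n + 1 + e) + (q + 1) * e : ℕ) : K) ≠ 0 := by
    rw [Nat.cast_ne_zero]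
    omega
  exact mul_ne_zero (mul_ne_zero h0 hγ) this e4

theorem no_eigen_recurrence {K : Type*} [Field K] [CharZero K]
    {g : ℕ → K[X]} {a1 l : K[X]} {a0 c : K} {m : ℕ} (h0 : a0 ≠ 0) (h1 : 0 < a1.natDegree)
    (hc : c ≠ 0) (hmpos : 0 < m) (hm : g m = C c) (hm1 : g (m + 1) = 0)
    (hzero : C a0 * g 1 = l * g 0)
    (hrec : ∀ j, j < m → derivative (g j) + C (a0 * (j + 2)) * g (j + 2) =
      (l - C ((j : K) + 1) * a1) * g (j + 1)) : False := by
  have ha1 : a1 ≠ 0 := by rintro rfl; simp at h1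
  have hcj : ∀ j : ℕ, (j : K) + 1 ≠ 0 := fun j => by exact_mod_cast j.succ_ne_zero
  have hdegC : ∀ j : ℕ, (C ((j : K) + 1) * a1).degree = (a1.natDegree : ℕ) := fun j => by
    rw [degree_C_mul (hcj j), degree_eq_natDegree ha1]
  by_cases hex : ∃ q, q < m ∧ (l - C ((q : K) + 1) * a1).degree < (a1.natDegree : ℕ)
  · obtain ⟨q, hqm, hq⟩ := hex
    have hg0 : g 0 ≠ 0 := by
      intro hg
      have : ∀ j, j ≤ m → g j = 0 ∧ g (j + 1) = 0 := by
        intro j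
        induction j with
        | zero => simpa [hg, h0] using hzero
        | succ j ih =>
          intro hj
          obtain ⟨h2, h3⟩ := ih (by omega)
          refine ⟨h3, ?_⟩
          have h4 := hrec j hj
          have h5 : (a0 * (j + 2) : K) ≠ 0 :=
            mul_ne_zero h0 (by exact_mod_cast (by omega : j + 2 ≠ 0))
          rw [h2, h3, derivative_zero, zero_add, mul_zero, mul_eq_zero, C_eq_zero] at h4
          exact h4.resolve_left h5
      have := (this m le_rfl).1
      rw [hm, C_eq_zero] at this
      exact hc this
    refine no_resonant_recurrence (μ := fun j => l - C (j : K) * a1) h0 h1 hc hm hm1 hqm hg0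
      (by simpa using hzero) (fun j hj => by simpa using hrec j hj) (by simpa using hq) ?_
    intro j
    simp
    ring
  · push Not at hex
    obtain ⟨r, hr⟩ : ∃ r : ℕ, ∀ q, q < m → (l - C ((q : K) + 1) * a1).degree = (r : ℕ) := by
      rcases le_or_gt l.degree (a1.natDegree : ℕ) with hl | hl
      · exact ⟨a1.natDegree, fun q hq => le_antisymm
          ((degree_sub_le _ _).trans (max_le hl (hdegC q).le)) (hex q hq)⟩
      · refine ⟨l.natDegree, fun q hq => ?_⟩
        rw [degree_sub_eq_left_of_degree_lt (by rwa [hdegC]), degree_eq_natDegree]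
        rintro rfl
        simp at hl
    obtain ⟨m, rfl⟩ := Nat.exists_eq_add_of_lt hmpos
    have top := degree_of_descending_recurrence (k := 0) (r := r)
      (μ := fun j => l - C (j : K) * a1) hc hm hm1 (fun j _ hj => by simpa using hrec j hj)
      (fun j hj hjm => by
        obtain ⟨j, rfl⟩ := Nat.exists_eq_add_of_lt hj
        simpa using hr j (by omega))
    have t1 := (top m 1 (by omega) (by omega)).1
    have t0 := (top (m + 1) 0 (by omega) (by omega)).1
    have := congrArg degree hzero
    rw [degree_C_mul h0, degree_mul, t1, t0] at this
    by_cases hl : l = 0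
    · rw [hl, degree_zero, WithBot.bot_add] at this
      exact WithBot.natCast_ne_bot _ this
    · rw [degree_eq_natDegree hl] at this
      norm_cast at this
      nlinarith

theorem coeffDerivative_map_C {K : Type*} [Field K] (p : K[X]) :
    coeffDerivative K (p.map C) = 0 := by
  ext n : 1
  rw [coeff_coeffDerivative, coeff_map, derivative_C, coeff_zero]

/-- The derivation `u ∂ₜ + v ∂_X` of `K[t][X]`. -/
noncomputable def planarDerivation {K : Type*} [Field K] (u v : K[X][X]) :
    Derivation K K[X][X] K[X][X] :=
  u • coeffDerivative K + v • derivative'.restrictScalars K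

theorem planarDerivation_apply {K : Type*} [Field K] (u v f : K[X][X]) :
    planarDerivation u v f = u * coeffDerivative K f + v * derivative f := rfl

theorem map_derivation_eq_planarDerivation {K : Type*} [Field K]
    (D : Derivation K (MvPolynomial (Fin 2) K) (MvPolynomial (Fin 2) K))
    (φ : MvPolynomial (Fin 2) K →ₐ[K] K[X][X]) {u v : K[X][X]}
    (h : ∀ i, φ (D (MvPolynomial.X i)) = planarDerivation u v (φ (MvPolynomial.X i)))
    (p : MvPolynomial (Fin 2) K) : φ (D p) = planarDerivation u v (φ p) := by
  induction p using MvPolynomial.induction_on with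
  | C a =>
    rw [← MvPolynomial.algebraMap_eq, Derivation.map_algebraMap, AlgHom.commutes,
      Derivation.map_algebraMap, map_zero]
  | add p q hp hq => rw [map_add, map_add, map_add, map_add, hp, hq]
  | mul_X p i hp =>
    rw [Derivation.leibniz, map_mul, Derivation.leibniz, map_add, smul_eq_mul, smul_eq_mul,
      smul_eq_mul, smul_eq_mul, map_mul, map_mul, hp, h]

theorem coeff_zero_planarDerivation {K : Type*} [Field K] (a1 : K[X]) (a0 : K) (f : K[X][X]) :
    (planarDerivation X (C a1 * X + C (C a0)) f).coeff 0 = C a0 * f.coeff 1 := by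
  simp [planarDerivation_apply, add_mul, mul_assoc, coeff_derivative]

theorem coeff_succ_planarDerivation {K : Type*} [Field K] (a1 : K[X]) (a0 : K) (f : K[X][X])
    (j : ℕ) : (planarDerivation X (C a1 * X + C (C a0)) f).coeff (j + 1) =
      derivative (f.coeff j) + C ((j : K) + 1) * a1 * f.coeff (j + 1)
        + C (a0 * (j + 2)) * f.coeff (j + 2) := by
  have h2 : (C (2 : K) : K[X]) = 2 := map_ofNat C 2
  simp [planarDerivation_apply, add_mul, mul_assoc, coeff_derivative, coeff_coeffDerivative, h2]
  ring

theorem eq_zero_or_isUnit_of_planarDerivation_eq_mul {K : Type*} [Field K] [CharZero K]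
    {a1 : K[X]} {a0 : K} (h0 : a0 ≠ 0) (h1 : 0 < a1.natDegree) {f l : K[X][X]}
    (h : planarDerivation X (C a1 * X + C (C a0)) f = l * f) : f = 0 ∨ IsUnit f := by
  by_cases hf : f = 0
  · exact Or.inl hf
  right
  set m := f.natDegree with hm
  have hlead : f.coeff m ≠ 0 := by simpa [hm] using hf
  have hbig : ∀ j, m < j → f.coeff j = 0 := fun j hj => coeff_eq_zero_of_natDegree_lt hj
  have hl1 : l.natDegree ≤ 1 := by
    by_cases hl : l = 0
    · simp [hl]
    have h2 : (l * f).natDegree ≤ m + 1 := by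
      rw [← h, natDegree_le_iff_coeff_eq_zero]
      intro N hN
      obtain ⟨N, rfl⟩ := Nat.exists_eq_add_of_lt hN
      rw [coeff_succ_planarDerivation, hbig (m + 1 + N) (by omega), hbig (m + 1 + N + 1) (by omega),
        hbig (m + 1 + N + 2) (by omega)]
      simp
    rw [natDegree_mul hl hf] at h2
    omega
  have htop : derivative (f.coeff m) = l.coeff 1 * f.coeff m := by
    have := congrArg (coeff · (1 + m)) h
    rw [coeff_mul_add_eq_of_natDegree_le hl1 hm.ge, add_comm 1 m, coeff_succ_planarDerivation,
      hbig (m + 1) (by omega), hbig (m + 2) (by omega), mul_zero, mul_zero, add_zero,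
      add_zero] at this
    exact this
  have hl0 : l.coeff 1 = 0 := by
    by_contra hne
    have h3 := degree_derivative_lt hlead
    rw [htop, degree_mul, degree_eq_natDegree hne, degree_eq_natDegree hlead] at h3
    norm_cast at h3
    omega
  obtain ⟨c, hc⟩ : ∃ c, f.coeff m = C c := by
    rw [hl0, zero_mul] at htop
    exact ⟨_, eq_C_of_derivative_eq_zero htop⟩
  have hc0 : c ≠ 0 := by
    rintro rfl
    rw [hc] at hlead
    simp at hlead
  have hl : l = C (l.coeff 0) := by
    conv_lhs => rw [eq_X_add_C_of_natDegree_le_one hl1]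
    simp [hl0]
  rcases Nat.eq_zero_or_pos m with hm0 | hmpos
  · rw [eq_C_of_natDegree_eq_zero (hm.symm.trans hm0), ← hm0, hc]
    exact isUnit_C.2 (isUnit_C.2 hc0.isUnit)
  · exfalso
    rw [hl] at h
    refine no_eigen_recurrence (g := f.coeff) (l := l.coeff 0) h0 h1 hc0 hmpos hc
      (hbig _ (by omega)) ?_ fun j _ => ?_
    · rw [← coeff_zero_planarDerivation a1, h, coeff_C_mul]
    · have := congrArg (coeff · (j + 1)) h
      rw [coeff_succ_planarDerivation, coeff_C_mul] at this
      linear_combination this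

theorem planarDerivation_ne_C_X {K : Type*} [Field K] [CharZero K]
    {a1 : K[X]} {a0 : K} (h0 : a0 ≠ 0) (h1 : 0 < a1.natDegree) (f : K[X][X]) :
    planarDerivation X (C a1 * X + C (C a0)) f ≠ C X := by
  intro h
  have hzero := congrArg (coeff · 0) h
  rw [coeff_zero_planarDerivation, coeff_C_zero] at hzero
  have hrec : ∀ j, derivative (f.coeff j) + C (a0 * (j + 2)) * f.coeff (j + 2) =
      (-C (j : K) * a1 - a1) * f.coeff (j + 1) := fun j => by
    have := congrArg (coeff · (j + 1)) h
    rw [coeff_succ_planarDerivation, coeff_C_succ, C_add, C_1] at this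
    linear_combination this
  set m := f.natDegree with hm
  have hbig : ∀ j, m < j → f.coeff j = 0 := fun j hj => coeff_eq_zero_of_natDegree_lt hj
  have hf1 : f.coeff 1 ≠ 0 := by
    intro hf
    rw [hf, mul_zero] at hzero
    exact X_ne_zero hzero.symm
  have hmpos : 0 < m := by
    by_contra hm0
    exact hf1 (hbig 1 (by omega))
  obtain ⟨n, hn⟩ := Nat.exists_eq_add_of_lt hmpos
  have hlead : f.coeff m ≠ 0 := by
    rw [hm, coeff_natDegree, leadingCoeff_ne_zero]
    rintro rfl
    simp at hf1
  obtain ⟨c, hc⟩ : ∃ c, f.coeff m = C c := by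
    have := hrec m
    rw [hbig (m + 1) (by omega), hbig (m + 2) (by omega), mul_zero, mul_zero, add_zero] at this
    exact ⟨_, eq_C_of_derivative_eq_zero this⟩
  have hc0 : c ≠ 0 := by
    rintro rfl
    rw [hc] at hlead
    simp at hlead
  have ha1 : a1 ≠ 0 := by rintro rfl; simp at h1
  have top := degree_of_descending_recurrence (g := f.coeff) (k := 0) (r := a1.natDegree)
    (μ := fun j => -C (j : K) * a1) hc0 hc (hbig _ (by omega))
    (fun j _ hj => by
      rw [hrec]
      push_cast
      rw [C_add, C_1]
      ring)
    (fun j hj _ => by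
      rw [← C_neg, degree_C_mul (neg_ne_zero.2 (by exact_mod_cast hj.ne')),
        degree_eq_natDegree ha1])
  have t1 := (top n 1 (by omega) (by omega)).1
  have := congrArg degree hzero
  rw [degree_C_mul h0, t1, degree_X] at this
  norm_cast at this
  have := Nat.eq_one_of_mul_eq_one_left this
  omega

theorem exists_C_mul_pow_dvd {R : Type*} [CommRing R] [IsDomain R] {I : Ideal R[X]} {p : R[X]}
    (hp : p ∈ I) (hp0 : p ≠ 0) (hmin : ∀ f ∈ I, f ≠ 0 → p.natDegree ≤ f.natDegree)
    {f : R[X]} (hf : f ∈ I) : ∃ c : R, c ≠ 0 ∧ p ∣ C c * f := by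
  induction hn : f.degree using WellFoundedLT.induction generalizing f with
  | ind d ih =>
    subst hn
    by_cases hf0 : f = 0
    · exact ⟨1, one_ne_zero, by simp [hf0]⟩
    have hle := hmin f hf hf0
    have hlp : p.leadingCoeff ≠ 0 := leadingCoeff_ne_zero.2 hp0
    have hlf : f.leadingCoeff ≠ 0 := leadingCoeff_ne_zero.2 hf0
    have hlt : (C p.leadingCoeff * f -
        C f.leadingCoeff * X ^ (f.natDegree - p.natDegree) * p).degree < f.degree := by
      have hd1 : (C p.leadingCoeff * f).degree = f.degree := degree_C_mul hlp
      rw [← hd1]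
      refine degree_sub_lt_left ?_ (mul_ne_zero (C_ne_zero.2 hlp) hf0) ?_
      · rw [hd1, degree_mul, degree_C_mul_X_pow _ hlf, degree_eq_natDegree hf0,
          degree_eq_natDegree hp0]
        norm_cast
        omega
      · simp only [leadingCoeff_mul, leadingCoeff_C, leadingCoeff_X_pow, mul_one]
        exact mul_comm _ _
    obtain ⟨c, hc, q, hq⟩ := ih _ hlt (I.sub_mem (I.mul_mem_left _ hf) (I.mul_mem_left _ hp)) rfl
    refine ⟨c * p.leadingCoeff, mul_ne_zero hc hlp,
      q + C c * (C f.leadingCoeff * X ^ (f.natDegree - p.natDegree)), ?_⟩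
    rw [C_mul]
    linear_combination hq

theorem Polynomial.IsPrimitive.dvd_of_dvd_C_mul_s2 {R : Type*} [CommRing R] [IsDomain R]
    [UniqueFactorizationMonoid R] {g f : R[X]} (hg : g.IsPrimitive) {c : R} (hc : c ≠ 0)
    (h : g ∣ C c * f) : g ∣ f := by
  let _ : NormalizedGCDMonoid R := Classical.choice inferInstance
  by_cases hf : f = 0
  · simp [hf]
  have hcf : C c * f ≠ 0 := mul_ne_zero (C_ne_zero.2 hc) hf
  rw [← hg.dvd_primPart_iff_dvd hcf, (associated_primPart_mul hcf).dvd_iff_dvd_right] at h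
  rw [← hg.dvd_primPart_iff_dvd hf]
  exact ((isUnit_primPart_C c).dvd_mul_left).1 h

theorem eq_top_of_C_mem {K : Type*} [Field K] [CharZero K] {a0 : K} (h0 : a0 ≠ 0) (v : K[X][X])
    {I : Ideal K[X][X]} (hI : ∀ f ∈ I, planarDerivation (C (C a0)) v f ∈ I)
    {p : K[X]} (hp0 : p ≠ 0) (hp : C p ∈ I) : I = ⊤ := by
  induction hn : p.natDegree using Nat.strong_induction_on generalizing p with
  | h n ih =>
    subst hn
    rcases Nat.eq_zero_or_pos p.natDegree with hd | hd
    · refine Ideal.eq_top_of_isUnit_mem _ hp (isUnit_C.2 ?_)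
      rw [eq_C_of_natDegree_eq_zero hd] at hp0 ⊢
      exact isUnit_C.2 (C_ne_zero.1 hp0).isUnit
    · refine ih (derivative p).natDegree (natDegree_derivative_lt hd.ne')
        (derivative_ne_zero.2 hd.ne') ?_ rfl
      have := I.mul_mem_left (C (C a0⁻¹)) (hI _ hp)
      rwa [planarDerivation_apply, coeffDerivative_C, derivative_C, mul_zero, add_zero, ← mul_assoc,
        ← C_mul, ← C_mul (R := K), inv_mul_cancel₀ h0, C_1, C_1, one_mul] at this

theorem eq_bot_or_eq_top_of_planarDerivation_mem {K : Type*} [Field K] [CharZero K] {a0 : K}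
    (h0 : a0 ≠ 0) (v : K[X][X])
    (hv : ∀ f l : K[X][X], planarDerivation (C (C a0)) v f = l * f → f = 0 ∨ IsUnit f)
    {I : Ideal K[X][X]} (hI : ∀ f ∈ I, planarDerivation (C (C a0)) v f ∈ I) : I = ⊥ ∨ I = ⊤ := by
  by_cases hbot : I = ⊥
  · exact Or.inl hbot
  right
  obtain ⟨p, ⟨hp, hp0⟩, hmin⟩ : ∃ p : K[X][X], (p ∈ I ∧ p ≠ 0) ∧
      ∀ f, f ∈ I ∧ f ≠ 0 → p.natDegree ≤ f.natDegree := by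
    obtain ⟨q, hq, hq0⟩ := Submodule.exists_mem_ne_zero_of_ne_bot hbot
    have hne : {f : K[X][X] | f ∈ I ∧ f ≠ 0}.Nonempty := ⟨q, hq, hq0⟩
    exact ⟨Function.argminOn natDegree _ hne, Function.argminOn_mem natDegree _ hne,
      fun f hf => Function.argminOn_le natDegree _ hf⟩
  let _ : NormalizedGCDMonoid K[X] := Classical.choice inferInstance
  have hcont : p.content ≠ 0 := by rwa [Ne, content_eq_zero_iff]
  have hpg := p.eq_C_content_mul_primPart
  have hprim := p.isPrimitive_primPart
  obtain ⟨c, hc, hdvd⟩ := exists_C_mul_pow_dvd hp hp0 (fun f hf hf0 => hmin f ⟨hf, hf0⟩) (hI p hp)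
  have h1 : p.primPart ∣ planarDerivation (C (C a0)) v p :=
    hprim.dvd_of_dvd_C_mul_s2 hc (p.primPart_dvd.trans hdvd)
  have h2 : p.primPart ∣ planarDerivation (C (C a0)) v p.primPart := by
    refine hprim.dvd_of_dvd_C_mul_s2 hcont ?_
    rw [hpg, Derivation.leibniz, smul_eq_mul, smul_eq_mul] at h1
    rw [← hpg] at h1
    exact (dvd_add_left (dvd_mul_right _ _)).1 h1
  obtain ⟨l, hl⟩ := h2
  have hu : IsUnit p.primPart := (hv _ l (hl.trans (mul_comm _ _))).resolve_left p.primPart_ne_zero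
  refine eq_top_of_C_mem h0 v hI hcont ?_
  obtain ⟨w, hw⟩ := hu.dvd (a := 1)
  have := I.mul_mem_right w hp
  rwa [hpg, mul_assoc, ← hw, mul_one] at this

theorem exists_derivative_eq {K : Type*} [Field K] [CharZero K] (h : K[X][X]) :
    ∃ f, derivative f = h := by
  induction h using Polynomial.induction_on' with
  | add p q hp hq =>
    obtain ⟨f, rfl⟩ := hp
    obtain ⟨g, rfl⟩ := hq
    exact ⟨f + g, derivative_add⟩
  | monomial n a =>
    refine ⟨monomial (n + 1) (C ((n : K) + 1)⁻¹ * a), ?_⟩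
    have hn : (n : K) + 1 ≠ 0 := by exact_mod_cast n.succ_ne_zero
    rw [derivative_monomial, Nat.add_sub_cancel, mul_right_comm]
    congr 1
    have : ((n + 1 : ℕ) : K[X]) = C ((n : K) + 1) := by simp
    rw [this, ← C_mul, inv_mul_cancel₀ hn, C_1, one_mul]

theorem exists_planarDerivation_eq {K : Type*} [Field K] [CharZero K] {a0 : K} (h0 : a0 ≠ 0) (c : K)
    (h : K[X][X]) : ∃ f, planarDerivation (C (C a0)) (C X + C (C c) * X) f = h := by
  induction h using Polynomial.induction_on' with
  | add p q hp hq =>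
    obtain ⟨f, rfl⟩ := hp
    obtain ⟨g, rfl⟩ := hq
    exact ⟨f + g, map_add _ _ _⟩
  | monomial n a =>
    induction n generalizing a with
    | zero =>
      obtain ⟨f, hf⟩ := exists_mul_derivative_add_mul_eq h0 0 a
      refine ⟨C f, ?_⟩
      rw [planarDerivation_apply, coeffDerivative_C, ← hf]
      simp
    | succ n ih =>
      obtain ⟨f, hf⟩ := exists_mul_derivative_add_mul_eq h0 (c * (n + 1)) a
      obtain ⟨g, hg⟩ := ih (C ((n : K) + 1) * X * f)
      refine ⟨C f * X ^ (n + 1) - g, ?_⟩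
      rw [map_sub, hg, ← hf, ← C_mul_X_pow_eq_monomial, ← C_mul_X_pow_eq_monomial,
        planarDerivation_apply, Derivation.leibniz, Derivation.leibniz_pow, coeffDerivative_C,
        coeffDerivative_X]
      simp
      ring

theorem not_isSimple_of_eigenvector {K : Type*} [Field K]
    {D : Derivation K (MvPolynomial (Fin 2) K) (MvPolynomial (Fin 2) K)}
    {p l : MvPolynomial (Fin 2) K} (h : D p = l * p) (v w : Fin 2 → K)
    (hv : MvPolynomial.eval v p = 0) (hw : MvPolynomial.eval w p ≠ 0) : ¬ D.IsSimple := by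
  intro hD
  have hstable : ∀ a ∈ Ideal.span {p}, D a ∈ Ideal.span {p} := by
    intro a ha
    obtain ⟨b, rfl⟩ := Ideal.mem_span_singleton'.1 ha
    rw [Derivation.leibniz, h, smul_eq_mul, smul_eq_mul]
    exact Ideal.mem_span_singleton'.2 ⟨b * l + D b, by ring⟩
  rcases hD _ hstable with hI | hI
  · rw [Ideal.span_singleton_eq_bot] at hI
    simp [hI] at hw
  · rw [Ideal.span_singleton_eq_top] at hI
    exact (hI.map (MvPolynomial.eval v)).ne_zero hv

theorem exists_algEquiv_X_C_X {K : Type*} [Field K] :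
    ∃ φ : MvPolynomial (Fin 2) K ≃ₐ[K] K[X][X],
      φ (MvPolynomial.X 0) = C X ∧ φ (MvPolynomial.X 1) = X := by
  let f : MvPolynomial (Fin 2) K →ₐ[K] K[X][X] := MvPolynomial.aeval ![C X, X]
  let g : K[X][X] →ₐ[K] MvPolynomial (Fin 2) K :=
    eval₂AlgHom (aeval (MvPolynomial.X 0)) (MvPolynomial.X 1) fun _ => Commute.all _ _
  have f0 : f (MvPolynomial.X 0) = C X := MvPolynomial.aeval_X _ _
  have f1 : f (MvPolynomial.X 1) = X := MvPolynomial.aeval_X _ _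
  have gC : ∀ p, g (C p) = aeval (MvPolynomial.X 0) p := fun p => eval₂_C _ _
  have gX : g X = MvPolynomial.X 1 := eval₂_X _ _
  have hfg : f.comp g = AlgHom.id K _ := by
    refine algHom_ext' (Polynomial.algHom_ext ?_) ?_
    · simp [gC, f0]
    · simp [gX, f1]
  have hgf : g.comp f = AlgHom.id K _ := by
    refine MvPolynomial.algHom_ext fun i => ?_
    fin_cases i
    · simp [f0, gC]
    · simp [f1, gX]
  exact ⟨AlgEquiv.ofAlgHom f g hfg hgf, f0, f1⟩

theorem exists_algEquiv_shear {K : Type*} [Field K] (A : K[X]) :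
    ∃ φ : MvPolynomial (Fin 2) K ≃ₐ[K] K[X][X],
      φ (MvPolynomial.X 0) = X ∧ φ (MvPolynomial.X 1) = C X + A.map C := by
  have hA : aeval (X : K[X][X]) A = A.map C := aeval_X_left_eq_map A
  let f : MvPolynomial (Fin 2) K →ₐ[K] K[X][X] := MvPolynomial.aeval ![X, C X + A.map C]
  let g : K[X][X] →ₐ[K] MvPolynomial (Fin 2) K :=
    eval₂AlgHom (aeval (MvPolynomial.X 1 - aeval (MvPolynomial.X 0) A)) (MvPolynomial.X 0)
      fun _ => Commute.all _ _
  have f0 : f (MvPolynomial.X 0) = X := MvPolynomial.aeval_X _ _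
  have f1 : f (MvPolynomial.X 1) = C X + A.map C := MvPolynomial.aeval_X _ _
  have gC : ∀ p, g (C p) = aeval (MvPolynomial.X 1 - aeval (MvPolynomial.X 0) A) p :=
    fun p => eval₂_C _ _
  have gX : g X = MvPolynomial.X 0 := eval₂_X _ _
  have hfg : f.comp g = AlgHom.id K _ := by
    refine algHom_ext' (Polynomial.algHom_ext ?_) ?_
    · simp [gC, f1, ← aeval_algHom_apply, f0, hA]
    · simp [gX, f0]
  have hgf : g.comp f = AlgHom.id K _ := by
    refine MvPolynomial.algHom_ext fun i => ?_
    fin_cases i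
    · simp [f0, gX]
    · simp [f1, gC, ← hA, ← aeval_algHom_apply, gX]
  exact ⟨AlgEquiv.ofAlgHom f g hfg hgf, f0, f1⟩

theorem isMathieuZhao_of_forall_mem {K R : Type*} [CommRing K] [CommRing R] [Algebra K R]
    {M : Submodule K R} (hM : ∀ a, a ∈ M) : M.IsMathieuZhao :=
  fun _ _ _ => ⟨0, fun _ _ => hM _⟩

theorem isMathieuZhao_of_mul_mem {K R : Type*} [CommRing K] [CommRing R] [Algebra K R]
    {M : Submodule K R} (hM : ∀ a ∈ M, ∀ b, b * a ∈ M) : M.IsMathieuZhao :=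
  fun _ ⟨N, hN⟩ b => ⟨N, fun m hm => hM _ (hN m hm) b⟩

theorem Submodule.IsMathieuZhao.mem_of_one_mem {K R : Type*} [CommRing K] [CommRing R] [Algebra K R]
    {M : Submodule K R} (hM : M.IsMathieuZhao) (h1 : 1 ∈ M) (b : R) : b ∈ M := by
  obtain ⟨N, hN⟩ := hM 1 ⟨0, fun m _ => by rwa [one_pow]⟩ b
  simpa using hN N le_rfl

theorem stmt_2 (K : Type*) [Field K] [CharZero K] (a1 : Polynomial K) (a0 : K)
    (D : Derivation K (MvPolynomial (Fin 2) K) (MvPolynomial (Fin 2) K))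
    (hDx : D (MvPolynomial.X 0) = MvPolynomial.X 1)
    (hDy : D (MvPolynomial.X 1) =
      Polynomial.aeval (MvPolynomial.X 0) a1 * MvPolynomial.X 1 + MvPolynomial.C a0) :
    D.IsSimple ↔ ¬ (LinearMap.range D.toLinearMap).IsMathieuZhao := by
  obtain ⟨ψ, ψ0, ψ1⟩ := exists_algEquiv_X_C_X (K := K)
  have hC : aeval (C X : K[X][X]) a1 = C a1 := by
    simpa using aeval_algHom_apply (CAlgHom : K[X] →ₐ[K] K[X][X]) X a1
  have hψ := map_derivation_eq_planarDerivation D ψ.toAlgHom (u := X) (v := C a1 * X + C (C a0)) (by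
    intro i
    fin_cases i
    · simp [planarDerivation_apply, hDx, ψ0, ψ1, coeffDerivative_C]
    · simp [planarDerivation_apply, hDy, ψ0, ψ1, coeffDerivative_X, ← aeval_algHom_apply, hC,
        show ψ (MvPolynomial.C a0) = C (C a0) from ψ.commutes a0])
  have hφ : ∀ A : K[X], derivative A = a1 → ∃ φ : MvPolynomial (Fin 2) K ≃ₐ[K] K[X][X],
      ∀ p, φ (D p) = planarDerivation (C (C a0)) (C X + A.map C) (φ p) := by
    intro A hA
    obtain ⟨φ, φ0, φ1⟩ := exists_algEquiv_shear A
    refine ⟨φ, map_derivation_eq_planarDerivation D φ.toAlgHom fun i => ?_⟩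
    fin_cases i
    · simp [planarDerivation_apply, hDx, φ0, φ1, coeffDerivative_X]
    · simp [planarDerivation_apply, hDy, φ0, φ1, coeffDerivative_C, coeffDerivative_map_C,
        ← aeval_algHom_apply, aeval_X_left_eq_map, hA,
        show φ (MvPolynomial.C a0) = C (C a0) from φ.commutes a0]
      ring
  obtain ⟨A, hA⟩ : ∃ A, derivative A = a1 := by
    simpa using exists_mul_derivative_add_mul_eq (one_ne_zero : (1 : K) ≠ 0) 0 a1
  by_cases h0 : a0 = 0
  · subst h0
    refine iff_of_false ?_ (not_not.2 ?_)
    · refine not_isSimple_of_eigenvector (p := MvPolynomial.X 1)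
        (l := aeval (MvPolynomial.X 0) a1) (by simpa using hDy) ![0, 0] ![0, 1] ?_ ?_ <;> simp
    · obtain ⟨φ, hD⟩ := hφ A hA
      simp only [planarDerivation_apply, C_0, zero_mul, zero_add] at hD
      refine isMathieuZhao_of_mul_mem ?_
      rintro _ ⟨p, rfl⟩ b
      obtain ⟨f, hf⟩ := exists_derivative_eq (φ b * derivative (φ p))
      refine ⟨φ.symm f, φ.injective ?_⟩
      change φ (D (φ.symm f)) = φ (b * D p)
      rw [map_mul, hD, hD, AlgEquiv.apply_symm_apply, hf]
      ring
  rcases Nat.eq_zero_or_pos a1.natDegree with h1 | h1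
  · obtain ⟨c, rfl⟩ : ∃ c, a1 = C c := ⟨_, eq_C_of_natDegree_eq_zero h1⟩
    refine iff_of_false ?_ (not_not.2 ?_)
    · by_cases hc : c = 0
      · subst hc
        refine not_isSimple_of_eigenvector (l := 0)
          (p := MvPolynomial.X 1 ^ 2 - MvPolynomial.C (2 * a0) * MvPolynomial.X 0) ?_
          ![0, 0] ![0, 1] ?_ ?_
        · have h2 : (MvPolynomial.C 2 : MvPolynomial (Fin 2) K) = 2 := map_ofNat _ 2
          have hD2 : D 2 = 0 := by exact_mod_cast D.map_natCast 2
          simp [hDx, hDy, Derivation.leibniz_pow, h2, hD2]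
          ring
        · simp
        · simp
      · refine not_isSimple_of_eigenvector (l := MvPolynomial.C c)
          (p := MvPolynomial.C c * MvPolynomial.X 1 + MvPolynomial.C a0) ?_
          ![0, -a0 / c] ![0, 0] ?_ ?_
        · simp [hDy]
        · simp
          field_simp
          ring
        · simpa using h0
    · obtain ⟨φ, hD⟩ := hφ (C c * X) (by simp)
      refine isMathieuZhao_of_forall_mem fun a => ?_
      obtain ⟨f, hf⟩ := exists_planarDerivation_eq h0 c (φ a)
      refine ⟨φ.symm f, φ.injective ?_⟩
      change φ (D (φ.symm f)) = φ a
      rw [hD, AlgEquiv.apply_symm_apply, ← hf]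
      simp
  · refine iff_of_true ?_ fun hMZ => ?_
    · obtain ⟨φ, hD⟩ := hφ A hA
      have hsymm : ∀ f, φ.symm (planarDerivation (C (C a0)) (C X + A.map C) f) = D (φ.symm f) :=
        fun f => by rw [AlgEquiv.symm_apply_eq, hD, AlgEquiv.apply_symm_apply]
      intro I hI
      have := eq_bot_or_eq_top_of_planarDerivation_mem h0 (C X + A.map C) (I := I.comap φ.symm) ?_ ?_
      · refine this.imp (fun hbot => ?_) fun htop => ?_
        · rw [eq_bot_iff]
          intro x hx
          have hx' : φ x ∈ I.comap φ.symm := by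
            rwa [Ideal.mem_comap, AlgEquiv.symm_apply_apply]
          rw [hbot, Ideal.mem_bot, map_eq_zero_iff φ φ.injective] at hx'
          exact hx'
        · exact (Ideal.comap_eq_top_iff).1 htop
      · intro f l hfl
        have h2 := congrArg φ.symm hfl
        rw [hsymm, map_mul] at h2
        have h3 := congrArg ψ h2
        rw [map_mul] at h3
        have := eq_zero_or_isUnit_of_planarDerivation_eq_mul h0 h1 ((hψ _).symm.trans h3)
        simpa using this
      · intro f hf
        rw [Ideal.mem_comap] at hf ⊢
        rw [hsymm]
        exact hI _ hf
    · have h1mem : (1 : MvPolynomial (Fin 2) K) ∈ LinearMap.range D.toLinearMap := by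
        refine ⟨a0⁻¹ • (MvPolynomial.X 1 - aeval (MvPolynomial.X 0) A), ?_⟩
        change D (a0⁻¹ • (MvPolynomial.X 1 - aeval (MvPolynomial.X 0) A)) = 1
        rw [D.map_smul, map_sub,
          Derivation.map_aeval, hDx, hDy, hA, smul_eq_mul, add_sub_cancel_left,
          MvPolynomial.smul_eq_C_mul, ← MvPolynomial.C_mul, inv_mul_cancel₀ h0, MvPolynomial.C_1]
      obtain ⟨f, hf⟩ := hMZ.mem_of_one_mem h1mem (MvPolynomial.X 0)
      refine planarDerivation_ne_C_X h0 h1 (ψ f) ?_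
      rw [← ψ0, ← hf]
      exact (hψ f).symm
end

section
/- Let K be a field of characteristic zero, a0 ∈ K* a nonzero constant, and a2(x) ∈ K[x] with deg a2(x) ≥ 1. Then the K-derivation D = y∂x + (a2(x)y² + a0)∂y of K[x,y] has no Darboux polynomial; that is, there exist no F ∈ K[x,y] with F ∉ K and no Λ ∈ K[x,y] such that D(F) = Λ·F. -/
open Polynomial in
theorem degree_derivative_add_C_mul_mul {K : Type*} [Field K] {a : K[X]} (ha : 1 ≤ a.degree)
    {c : K} (hc : c ≠ 0) (f : K[X]) :
    (derivative f + C c * a * f).degree = a.degree + f.degree := by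
  rcases eq_or_ne f 0 with rfl | hf
  · simp
  have hdeg : (C c * a * f).degree = a.degree + f.degree := by
    rw [degree_mul, degree_mul, degree_C hc, zero_add]
  rw [degree_add_eq_right_of_degree_lt, hdeg]
  rw [hdeg]
  refine (degree_derivative_lt hf).trans_le ?_
  calc f.degree = 0 + f.degree := (zero_add _).symm
    _ ≤ a.degree + f.degree := by
      gcongr
      exact zero_le_one.trans ha

open Polynomial in
theorem eq_zero_and_degree_eq_zero_of_derivative_eq_mul {K : Type*} [Field K] [CharZero K]
    {f l : K[X]} (hf : f ≠ 0) (h : derivative f = l * f) : l = 0 ∧ f.degree = 0 := by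
  have hl : l = 0 := by
    by_contra hl
    have hlt := degree_derivative_lt hf
    rw [h, mul_comm] at hlt
    exact absurd hlt (not_lt.2 (degree_le_mul_left f hl))
  refine ⟨hl, ?_⟩
  rw [hl, zero_mul] at h
  rw [eq_C_of_derivative_eq_zero h] at hf ⊢
  exact degree_C (by simpa using hf)

open Polynomial in
/-- The recurrence satisfied by the coefficients, with respect to `y`, of a Darboux polynomial of
`y ∂x + (a y² + b) ∂y` with cofactor `l₁ y + l₀` has no solution of positive degree in `y`. -/
theorem not_darboux_coeff_recurrence {K : Type*} [Field K] [CharZero K]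
    {a : K[X]} (ha : 1 ≤ a.degree) {b : K} (hb : b ≠ 0) {f : ℕ → K[X]} {n : ℕ} (hn : n ≠ 0)
    (hfn : f n ≠ 0) (hf : ∀ k, n < k → f k = 0) {l₀ l₁ : K[X]}
    (h_zero : C b * f 1 = l₀ * f 0)
    (h_succ : ∀ k : ℕ, derivative (f k) + C (k : K) * a * f k + C ((k + 2 : ℕ) * b) * f (k + 2) =
      l₁ * f k + l₀ * f (k + 1)) : False := by
  have hder : derivative (f n) = (l₁ - C (n : K) * a) * f n := by
    have := h_succ n
    rw [hf (n + 2) (by omega), hf (n + 1) (by omega)] at this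
    linear_combination this
  obtain ⟨hl₁, hfn0⟩ := eq_zero_and_degree_eq_zero_of_derivative_eq_mul hfn hder
  have hrec (k : ℕ) : derivative (f k) + C ((k : K) - n) * a * f k =
      l₀ * f (k + 1) - C ((k + 2 : ℕ) * b) * f (k + 2) := by
    rw [C_sub]
    linear_combination h_succ k + f k * hl₁
  have hdeg (k : ℕ) (hk : k < n) : a.degree + (f k).degree =
      (l₀ * f (k + 1) - C ((k + 2 : ℕ) * b) * f (k + 2)).degree := by
    rw [← hrec k, degree_derivative_add_C_mul_mul ha]
    exact sub_ne_zero.2 (by exact_mod_cast hk.ne)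
  have hcoef (k : ℕ) : ((k + 2 : ℕ) : K) * b ≠ 0 := mul_ne_zero (by exact_mod_cast Nat.succ_ne_zero (k + 1)) hb
  have ha_ne : a.degree ≠ ⊥ := fun h => by simp [h] at ha
  obtain ⟨m, rfl⟩ := Nat.exists_eq_succ_of_ne_zero hn
  have hm := hdeg m (by omega)
  rw [hf (m + 2) (by omega), mul_zero, sub_zero, degree_mul, hfn0, add_zero] at hm
  have hl₀ : l₀ ≠ 0 := by
    rintro rfl
    cases m with
    | zero => simp_all
    | succ m =>
      have h1 := hdeg m (by omega)
      rw [zero_mul, zero_sub, degree_neg, degree_C_mul (hcoef m), hfn0] at h1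
      have h2 : f m ≠ 0 := by
        rintro h
        simp [h] at h1
      have h3 : (1 : WithBot ℕ) + 0 ≤ a.degree + (f m).degree :=
        add_le_add ha (zero_le_degree_iff.2 h2)
      rw [h1] at h3
      exact absurd h3 (by decide)
  have hfm : f m ≠ 0 := by
    rintro h
    rw [h, degree_zero, WithBot.add_bot] at hm
    exact hl₀ (degree_eq_bot.1 hm.symm)
  have hal₀ : a.degree ≤ l₀.degree := by
    rw [← hm]
    exact le_add_of_nonneg_right (zero_le_degree_iff.2 hfm)
  have hlt {p q : K[X]} (hp : p ≠ 0) (hqp : q.degree ≤ p.degree) {c : K} (hc : c ≠ 0) :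
      (C c * q).degree < (l₀ * p).degree := by
    rw [degree_C_mul hc, degree_mul]
    have h1 : (1 : WithBot ℕ) ≤ l₀.degree := ha.trans hal₀
    rw [degree_eq_natDegree hl₀] at h1 ⊢
    rw [degree_eq_natDegree hp] at hqp ⊢
    refine hqp.trans_lt ?_
    norm_cast at h1 ⊢
    omega
  have key (j : ℕ) : ∀ k, k + j = m + 1 → f k ≠ 0 ∧ (f (k + 1)).degree ≤ (f k).degree := by
    induction j with
    | zero =>
      rintro k rfl
      exact ⟨hfn, by simp [hf (m + 1 + 1) (by omega)]⟩
    | succ j ih =>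
      intro k hk
      obtain ⟨h1, h2⟩ := ih (k + 1) (by omega)
      have h3 := hdeg k (by omega)
      rw [degree_sub_eq_left_of_degree_lt (hlt h1 h2 (hcoef k)), degree_mul] at h3
      have h4 : f k ≠ 0 := by
        rintro h
        rw [h, degree_zero, WithBot.add_bot, ← degree_mul] at h3
        exact mul_ne_zero hl₀ h1 (degree_eq_bot.1 h3.symm)
      refine ⟨h4, ?_⟩
      rw [← WithBot.add_le_add_iff_left ha_ne, h3]
      gcongr
  obtain ⟨h1, h2⟩ := key (m + 1) 0 (by omega)
  exact (hlt h1 h2 hb).ne (by rw [h_zero])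

open Polynomial in
/-- The identification of `K[x, y]` with `K[x][y]`. -/
noncomputable def bivariateToIterated (K : Type*) [Field K] :
    MvPolynomial (Fin 2) K →ₐ[K] K[X][X] :=
  MvPolynomial.aeval ![C X, X]

open Polynomial in
theorem eq_C_of_bivariateToIterated_eq {K : Type*} [Field K] {F : MvPolynomial (Fin 2) K} {k : K}
    (h : bivariateToIterated K F = C (C k)) : F = MvPolynomial.C k := by
  let ψ : K[X][X] →+* MvPolynomial (Fin 2) K :=
    eval₂RingHom (aeval (MvPolynomial.X 0) : K[X] →ₐ[K] MvPolynomial (Fin 2) K).toRingHom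
      (MvPolynomial.X 1)
  have hψ : ψ.comp (bivariateToIterated K).toRingHom = RingHom.id _ := by
    refine MvPolynomial.ringHom_ext (fun r => ?_) fun i => ?_
    · simp [ψ, bivariateToIterated, Polynomial.algebraMap_apply, MvPolynomial.algebraMap_eq]
    · fin_cases i <;> simp [ψ, bivariateToIterated]
  have := congrArg ψ h
  rw [show ψ (bivariateToIterated K F) = F from RingHom.congr_fun hψ F] at this
  simpa [ψ, MvPolynomial.algebraMap_eq] using this

open Polynomial in
theorem coeff_bivariateToIterated_derivation {K : Type*} [Field K] {a : K[X]} {b : K}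
    {D : Derivation K (MvPolynomial (Fin 2) K) (MvPolynomial (Fin 2) K)}
    (hDx : D (MvPolynomial.X 0) = MvPolynomial.X 1)
    (hDy : D (MvPolynomial.X 1) =
      aeval (MvPolynomial.X 0) a * MvPolynomial.X 1 ^ 2 + MvPolynomial.C b)
    (F : MvPolynomial (Fin 2) K) :
    (bivariateToIterated K (D F)).coeff 0 = C b * (bivariateToIterated K F).coeff 1 ∧
    ∀ k, (bivariateToIterated K (D F)).coeff (k + 1) =
      derivative ((bivariateToIterated K F).coeff k) +
        C (k : K) * a * (bivariateToIterated K F).coeff k +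
        C ((k + 2 : ℕ) * b) * (bivariateToIterated K F).coeff (k + 2) := by
  have hx : bivariateToIterated K (MvPolynomial.X 0) = C X := by simp [bivariateToIterated]
  have hy : bivariateToIterated K (MvPolynomial.X 1) = X := by simp [bivariateToIterated]
  have hC (r : K) : bivariateToIterated K (MvPolynomial.C r) = C (C r) := by
    simp [bivariateToIterated, Polynomial.algebraMap_apply]
  have ha : bivariateToIterated K (aeval (MvPolynomial.X 0) a) = C a := by
    rw [← aeval_algHom_apply, hx]
    have := aeval_algHom_apply (CAlgHom : K[X] →ₐ[K] K[X][X]) X a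
    simpa using this
  induction F using MvPolynomial.induction_on with
  | C r =>
    have : D (MvPolynomial.C r) = 0 := D.map_algebraMap r
    rw [this, hC]
    refine ⟨by simp, fun k => ?_⟩
    cases k <;> simp [coeff_C]
  | add p q hp hq =>
    refine ⟨?_, fun k => ?_⟩
    · simp only [map_add, coeff_add, hp.1, hq.1]
      ring
    · simp only [map_add, coeff_add, hp.2, hq.2]
      ring
  | mul_X p i hp =>
    obtain ⟨hp0, hp1⟩ := hp
    rw [D.leibniz]
    fin_cases i
    · simp only [Fin.zero_eta, hDx, smul_eq_mul, map_add, map_mul, hx, hy]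
      refine ⟨?_, fun k => ?_⟩
      · simp [hp0]
        ring
      · simp [hp1, coeff_C_mul, coeff_mul_X]
        ring
    · simp only [Fin.mk_one, hDy, smul_eq_mul, map_add, map_mul, map_pow, ha, hC, hy]
      rw [mul_add, ← mul_assoc]
      refine ⟨?_, fun k => ?_⟩
      · simp [mul_coeff_zero, coeff_mul_X]
        ring
      · rcases k with _ | k
        · simp [coeff_mul_X, coeff_X_mul, hp0, coeff_mul_X_pow', show (C (2 : K) : K[X]) = 2 from rfl]
          ring
        · simp [coeff_mul_X, coeff_X_mul, hp1, coeff_mul_X_pow]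
          ring

theorem stmt_11 (K : Type*) [Field K] [CharZero K]
    (a0 : K) (ha0 : a0 ≠ 0)
    (a2 : Polynomial K) (ha2 : 1 ≤ a2.degree)
    (D : Derivation K (MvPolynomial (Fin 2) K) (MvPolynomial (Fin 2) K))
    (hDx : D (MvPolynomial.X 0) = MvPolynomial.X 1)
    (hDy : D (MvPolynomial.X 1) =
      Polynomial.aeval (MvPolynomial.X 0) a2 * MvPolynomial.X 1 ^ 2 +
        MvPolynomial.C a0) :
    ¬ ∃ (F Λ : MvPolynomial (Fin 2) K),
        (∀ k : K, F ≠ MvPolynomial.C k) ∧ D F = Λ * F := by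
  rintro ⟨F, Λ, hF, hD⟩
  obtain ⟨h0, h1⟩ := coeff_bivariateToIterated_derivation hDx hDy F
  rw [hD, map_mul] at h0 h1
  have hPC (k : K) : bivariateToIterated K F ≠ Polynomial.C (Polynomial.C k) :=
    fun h => hF k (eq_C_of_bivariateToIterated_eq h)
  generalize bivariateToIterated K F = P at h0 h1 hPC
  generalize bivariateToIterated K Λ = L at h0 h1
  have hP : P ≠ 0 := by simpa using hPC 0
  have hvanish (k : ℕ) (hk : P.natDegree < k) : P.coeff k = 0 :=
    Polynomial.coeff_eq_zero_of_natDegree_lt hk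
  have hL : L.natDegree ≤ 1 := by
    rcases eq_or_ne L 0 with rfl | hL
    · simp
    have : (L * P).natDegree ≤ P.natDegree + 1 := by
      rw [Polynomial.natDegree_le_iff_coeff_eq_zero]
      intro k hk
      obtain ⟨k, rfl⟩ : ∃ j, k = j + 1 := ⟨k - 1, by omega⟩
      rw [h1, hvanish k (by omega), hvanish (k + 2) (by omega)]
      simp
    rw [Polynomial.natDegree_mul hL hP] at this
    omega
  rw [Polynomial.eq_X_add_C_of_natDegree_le_one hL] at h0 h1
  generalize L.coeff 0 = l₀ at h0 h1
  generalize L.coeff 1 = l₁ at h0 h1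
  have h_succ (k : ℕ) : Polynomial.derivative (P.coeff k) +
      Polynomial.C (k : K) * a2 * P.coeff k +
      Polynomial.C ((k + 2 : ℕ) * a0) * P.coeff (k + 2) =
        l₁ * P.coeff k + l₀ * P.coeff (k + 1) := by
    rw [← h1, add_mul, mul_assoc, Polynomial.coeff_add, Polynomial.coeff_C_mul,
      Polynomial.coeff_C_mul, Polynomial.coeff_X_mul]
  have h_zero : Polynomial.C a0 * P.coeff 1 = l₀ * P.coeff 0 := by
    rw [← h0]
    simp [Polynomial.mul_coeff_zero]
  refine not_darboux_coeff_recurrence ha2 ha0 (n := P.natDegree) ?_ (by simpa using hP) hvanish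
    h_zero h_succ
  intro hn
  have hP0 : P = Polynomial.C (P.coeff 0) := Polynomial.eq_C_of_natDegree_eq_zero hn
  have hc : P.coeff 0 ≠ 0 := fun h => hP (by rw [hP0, h, map_zero])
  have hder : Polynomial.derivative (P.coeff 0) = l₁ * P.coeff 0 := by
    simpa [hvanish 1 (by omega), hvanish 2 (by omega)] using h_succ 0
  refine hPC ((P.coeff 0).coeff 0) ?_
  rw [← Polynomial.eq_C_of_degree_eq_zero
    (eq_zero_and_degree_eq_zero_of_derivative_eq_mul hc hder).2]
  exact hP0
end
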